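/- arXiv:1605.04501 — 5 statements merged into one kernel-verified Lean document; each statement's English description precedes it below -/
import Mathlib

section
/- Let m ≥ 1 be an integer and let φ be a proper (2m−1)-edge-coloring of the complete graph K_{2m}. Then K_{2m} contains at least ⌊√(6m+9)/3⌋ pairwise edge-disjoint rainbow spanning trees. -/
/-- A proper edge-coloring of the complete graph on `Fin n`: any two distinct
edges sharing a vertex receive distinct colors. -/
def ProperEdgeColoring {n c : ℕ} (φ : Sym2 (Fin n) → Fin c) : Prop :=
  ∀ a b₁ b₂ : Fin n, a ≠ b₁ → a ≠ b₂ → b₁ ≠ b₂ → φ s(a, b₁) ≠ φ s(a, b₂)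

namespace RainbowTrees

variable {V C : Type*}

/-- Edges of the tree with root `r` and parent function `p`. -/
def treeEdges (r : V) (p : V → V) : Set (Sym2 V) := {e | ∃ v, v ≠ r ∧ e = s(v, p v)}

/-- The parent function `p` describes a rainbow spanning tree with root `r`. -/
structure IsRainbowTree (φ : Sym2 V → C) (r : V) (p : V → V) : Prop where
  height : ∃ h : V → ℕ, ∀ v, v ≠ r → h (p v) < h v
  inj : ∀ u v, u ≠ r → v ≠ r → φ s(u, p u) = φ s(v, p v) → u = v

/-- `M c v` is the neighbour of `v` along the edge of colour `c`. -/
structure IsMate (φ : Sym2 V → C) (M : C → V → V) : Prop where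
  ne : ∀ c v, M c v ≠ v
  color : ∀ c v, φ s(v, M c v) = c
  eq : ∀ u v, u ≠ v → M (φ s(u, v)) u = v

namespace IsMate

variable {φ : Sym2 V → C} {M : C → V → V}

lemma eq_of_color (hM : IsMate φ M) {a b b' : V} (h : a ≠ b) (h' : a ≠ b')
    (e : φ s(a, b) = φ s(a, b')) : b = b' := by
  rw [← hM.eq a b h, e, hM.eq a b' h']

lemma symm (hM : IsMate φ M) (c : C) (v : V) : M c (M c v) = v := by
  have h := hM.eq (M c v) v (hM.ne c v)
  rwa [Sym2.eq_swap, hM.color] at h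

lemma eq_mate (hM : IsMate φ M) {y r : V} (a : V) (hy : y ≠ r) :
    M (φ s(a, M (φ s(y, r)) a)) r = y := by
  rw [hM.color, Sym2.eq_swap, hM.eq r y hy.symm]

end IsMate

namespace IsRainbowTree

variable {φ : Sym2 V → C} {r : V} {p : V → V}

lemma parent_ne (hT : IsRainbowTree φ r p) {v : V} (hv : v ≠ r) : p v ≠ v := by
  obtain ⟨h, hh⟩ := hT.height
  intro e
  have := hh v hv
  rw [e] at this
  exact lt_irrefl _ this

lemma eq_of_mem (hT : IsRainbowTree φ r p) {v : V} (hv : v ≠ r) {e : Sym2 V}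
    (he : e ∈ treeEdges r p) (hc : φ e = φ s(v, p v)) : e = s(v, p v) := by
  obtain ⟨u, hu, rfl⟩ := he
  rw [hT.inj u v hu hv hc]

lemma isTree [Fintype V] [DecidableEq V] (hT : IsRainbowTree φ r p) :
    (SimpleGraph.fromEdgeSet (treeEdges r p)).IsTree ∧
    (SimpleGraph.fromEdgeSet (treeEdges r p)).edgeSet = treeEdges r p := by
  have hE : (SimpleGraph.fromEdgeSet (treeEdges r p)).edgeSet = treeEdges r p := by
    rw [SimpleGraph.edgeSet_fromEdgeSet]
    ext e
    simp only [Set.mem_sdiff, and_iff_left_iff_imp]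
    rintro ⟨v, hv, rfl⟩
    simpa using (hT.parent_ne hv).symm
  refine ⟨?_, hE⟩
  rw [SimpleGraph.isTree_iff_connected_and_card]
  constructor
  · obtain ⟨h, hh⟩ := hT.height
    have key : ∀ n v, h v = n → (SimpleGraph.fromEdgeSet (treeEdges r p)).Reachable v r := by
      intro n
      induction n using Nat.strong_induction_on with
      | _ n ih =>
        intro v hn
        by_cases hv : v = r
        · rw [hv]
        · have ha : (SimpleGraph.fromEdgeSet (treeEdges r p)).Adj v (p v) := by
            rw [SimpleGraph.fromEdgeSet_adj]
            exact ⟨⟨v, hv, rfl⟩, (hT.parent_ne hv).symm⟩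
          exact ha.reachable.trans (ih _ (hn ▸ hh v hv) _ rfl)
    have : Nonempty V := ⟨r⟩
    exact ⟨fun u v => (key _ u rfl).trans (key _ v rfl).symm⟩
  · rw [hE]
    have h1 : treeEdges r p = (fun v => s(v, p v)) '' ({r}ᶜ : Set V) := by
      ext e
      simp only [treeEdges, Set.mem_ofPred_eq, Set.mem_image, Set.mem_compl_iff,
        Set.mem_singleton_iff]
      exact ⟨fun ⟨v, hv, he⟩ => ⟨v, hv, he.symm⟩, fun ⟨v, hv, he⟩ => ⟨v, hv, he.symm⟩⟩
    rw [h1, Nat.card_image_of_injOn]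
    · have := Set.ncard_compl ({r} : Set V)
      rw [Nat.card_coe_set_eq, this, Set.ncard_singleton]
      have : 0 < Nat.card V := Nat.card_pos_iff.2 ⟨⟨r⟩, inferInstance⟩
      omega
    · intro u hu v hv e
      exact hT.inj u v hu hv (congrArg φ e)

end IsRainbowTree

/-- Exchange the parents of the two leaves `a`, `b` of the root `r`, preserving the colours used. -/
def swap [DecidableEq V] (φ : Sym2 V → C) (M : C → V → V) (r : V) (p : V → V) (a b : V) : V → V :=
  Function.update (Function.update p a (M (φ s(b, r)) a)) b (M (φ s(a, r)) b)

section Swap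

variable [DecidableEq V] {φ : Sym2 V → C} {M : C → V → V} {r : V} {p : V → V} {a b : V}

lemma swap_left (hab : a ≠ b) : swap φ M r p a b a = M (φ s(b, r)) a := by
  simp [swap, hab]

lemma swap_right : swap φ M r p a b b = M (φ s(a, r)) b := by
  simp [swap]

lemma swap_of_ne {v : V} (ha : v ≠ a) (hb : v ≠ b) : swap φ M r p a b v = p v := by
  simp [swap, ha, hb]

lemma mem_treeEdges_swap (hab : a ≠ b) {e : Sym2 V} (he : e ∈ treeEdges r (swap φ M r p a b)) :
    e ∈ treeEdges r p ∨ e = s(a, M (φ s(b, r)) a) ∨ e = s(b, M (φ s(a, r)) b) := by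
  obtain ⟨v, hv, rfl⟩ := he
  by_cases ha : v = a
  · subst ha; rw [swap_left hab]; simp
  by_cases hb : v = b
  · subst hb; rw [swap_right]; simp
  · rw [swap_of_ne ha hb]; exact Or.inl ⟨v, hv, rfl⟩

lemma IsRainbowTree.swap (hM : IsMate φ M) (hT : IsRainbowTree φ r p)
    (ha : a ≠ r) (hb : b ≠ r) (hab : a ≠ b) (hpa : p a = r) (hpb : p b = r)
    (hla : ∀ v, v ≠ r → p v ≠ a) (hlb : ∀ v, v ≠ r → p v ≠ b) :
    IsRainbowTree φ r (swap φ M r p a b) := by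
  have hAb : M (φ s(b, r)) a ≠ b := by
    intro e
    have h1 := hM.color (φ s(b, r)) a
    rw [e, Sym2.eq_swap] at h1
    exact ha (hM.eq_of_color hab.symm hb h1)
  have hBa : M (φ s(a, r)) b ≠ a := by
    intro e
    have h1 := hM.color (φ s(a, r)) b
    rw [e, Sym2.eq_swap] at h1
    exact hb (hM.eq_of_color hab ha h1)
  constructor
  · obtain ⟨h, hh⟩ := hT.height
    set A := M (φ s(b, r)) a with hA
    set B := M (φ s(a, r)) b with hB
    refine ⟨fun v => if v = a ∨ v = b then h A + h B + 1 else h v, fun v hv => ?_⟩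
    have hAa : A ≠ a := hM.ne _ _
    have hBb : B ≠ b := hM.ne _ _
    by_cases hva : v = a
    · subst hva
      rw [swap_left hab, ← hA]
      simp [hAa, hAb]
    by_cases hvb : v = b
    · subst hvb
      rw [swap_right, ← hB]
      simp [hBa, hBb]
    rw [swap_of_ne hva hvb]
    simpa [hva, hvb, hla v hv, hlb v hv] using hh v hv
  · -- up to transposing `a` and `b`, every vertex keeps the colour of its parent edge
    have key : ∀ v, φ s(v, RainbowTrees.swap φ M r p a b v) =
        φ s(Equiv.swap a b v, p (Equiv.swap a b v)) := by
      intro v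
      by_cases hva : v = a
      · subst hva
        rw [swap_left hab, hM.color, Equiv.swap_apply_left, hpb]
      by_cases hvb : v = b
      · subst hvb
        rw [swap_right, hM.color, Equiv.swap_apply_right, hpa]
      rw [swap_of_ne hva hvb, Equiv.swap_apply_of_ne_of_ne hva hvb]
    have hr : ∀ v, v ≠ r → Equiv.swap a b v ≠ r := by
      intro v hv e
      apply hv
      rw [← Equiv.swap_apply_of_ne_of_ne ha.symm hb.symm] at e
      exact (Equiv.swap a b).injective e
    intro u v hu hv e
    rw [key, key] at e
    exact (Equiv.swap a b).injective (hT.inj _ _ (hr u hu) (hr v hv) e)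

end Swap

section System

variable [DecidableEq V] {k : ℕ}

/-- The trees `l` and `m` both contain the edge joining their roots. -/
def conflicts (x : Fin k → V) (P : Fin k → V → V) (l : Fin k) : Finset (Fin k) :=
  {m | m ≠ l ∧ P l (x m) = x l ∧ P m (x l) = x m}

lemma mem_conflicts_comm {x : Fin k → V} {P : Fin k → V → V} {i j : Fin k} :
    j ∈ conflicts x P i ↔ i ∈ conflicts x P j := by
  simp only [conflicts, Finset.mem_filter, Finset.mem_univ, true_and]
  exact ⟨fun ⟨h, h', h''⟩ => ⟨h.symm, h'', h'⟩, fun ⟨h, h', h''⟩ => ⟨h.symm, h'', h'⟩⟩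

variable [Fintype V]

/-- Vertices other than the root that are not children of the root. -/
def deep (r : V) (p : V → V) : Finset V := {v | v ≠ r ∧ p v ≠ r}

/-- Vertices lying on an edge that avoids the root. -/
def dirty (r : V) (p : V → V) : Finset V := deep r p ∪ (deep r p).image p

lemma card_dirty_le (r : V) (p : V → V) : (dirty r p).card ≤ 2 * (deep r p).card := by
  have h1 := Finset.card_union_le (deep r p) ((deep r p).image p)
  have h2 := Finset.card_image_le (s := deep r p) (f := p)
  unfold dirty
  omega

lemma eq_root_of_notMem_dirty {r v : V} {p : V → V} (hv : v ≠ r) (h : v ∉ dirty r p) :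
    p v = r := by
  by_contra h'
  exact h (Finset.mem_union_left _ (by simp [deep, hv, h']))

lemma ne_of_notMem_dirty {r v : V} {p : V → V} (hv : v ≠ r) (h : v ∉ dirty r p) :
    ∀ u, u ≠ r → p u ≠ v := by
  rintro u hu rfl
  exact h (Finset.mem_union_right _ (Finset.mem_image_of_mem _ (by simp [deep, hv, hu])))

lemma card_deep_swap_le (φ : Sym2 V → C) (M : C → V → V) (r : V) (p : V → V) (a b : V) :
    (deep r (swap φ M r p a b)).card ≤ (deep r p).card + 2 := by
  have h : deep r (swap φ M r p a b) ⊆ deep r p ∪ {a, b} := by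
    intro v hv
    simp only [deep, Finset.mem_filter, Finset.mem_univ, true_and, Finset.mem_union,
      Finset.mem_insert, Finset.mem_singleton] at hv ⊢
    by_contra hcon
    push Not at hcon
    rw [swap_of_ne hcon.2.1 hcon.2.2] at hv
    exact hv.2 (hcon.1 hv.1)
  refine (Finset.card_le_card h).trans ((Finset.card_union_le _ _).trans ?_)
  have := Finset.card_le_two (a := a) (b := b)
  omega

/-- The neighbours of `w` other than the root, together with the remaining deep vertices. -/
def deepNeighbors (r : V) (p : V → V) (w : V) : Finset V :=
  (deep r p).image fun v => if v = w then p w else v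

lemma mem_deepNeighbors {φ : Sym2 V → C} {r w u : V} {p : V → V} (hT : IsRainbowTree φ r p)
    (hw : w ≠ r) (hu : u ≠ r) (h : s(w, u) ∈ treeEdges r p) : u ∈ deepNeighbors r p w := by
  obtain ⟨v, hv, e⟩ := h
  simp only [deepNeighbors, deep, Finset.mem_image, Finset.mem_filter, Finset.mem_univ, true_and]
  rcases Sym2.eq_iff.1 e with ⟨rfl, rfl⟩ | ⟨rfl, rfl⟩
  · exact ⟨w, ⟨hv, hu⟩, by simp⟩
  · exact ⟨u, ⟨hv, hw⟩, by rw [if_neg (hT.parent_ne hv).symm]⟩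

/-- The endpoints of the edge of colour `c`. -/
def colorEnds [DecidableEq C] (φ : Sym2 V → C) (r : V) (p : V → V) (c : C) : Finset V :=
  ({v | v ≠ r ∧ φ s(v, p v) = c} : Finset V) ∪ ({v | v ≠ r ∧ φ s(v, p v) = c} : Finset V).image p

lemma card_colorEnds_le [DecidableEq C] {φ : Sym2 V → C} {r : V} {p : V → V}
    (hT : IsRainbowTree φ r p) (c : C) : (colorEnds φ r p c).card ≤ 2 := by
  have h1 : ({v | v ≠ r ∧ φ s(v, p v) = c} : Finset V).card ≤ 1 := by
    rw [Finset.card_le_one]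
    intro u hu v hv
    simp only [Finset.mem_filter, Finset.mem_univ, true_and] at hu hv
    exact hT.inj u v hu.1 hv.1 (hu.2.trans hv.2.symm)
  refine (Finset.card_union_le _ _).trans ?_
  have h2 := Finset.card_image_le (s := ({v | v ≠ r ∧ φ s(v, p v) = c} : Finset V)) (f := p)
  omega

lemma mem_colorEnds [DecidableEq C] {φ : Sym2 V → C} {r v t : V} {p : V → V} {c : C}
    (h : s(v, t) ∈ treeEdges r p) (hc : φ s(v, t) = c) : v ∈ colorEnds φ r p c := by
  obtain ⟨u, hu, e⟩ := h
  rw [e] at hc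
  simp only [colorEnds, Finset.mem_union, Finset.mem_image, Finset.mem_filter, Finset.mem_univ,
    true_and]
  rcases Sym2.eq_iff.1 e with ⟨rfl, -⟩ | ⟨rfl, -⟩
  · exact Or.inl ⟨hu, hc⟩
  · exact Or.inr ⟨u, ⟨hu, hc⟩, rfl⟩

/-- A system of rainbow spanning trees with distinct roots, any two of which share at most the edge
joining their roots, and which are close to stars. -/
structure IsSystem (φ : Sym2 V → C) (x : Fin k → V) (P : Fin k → V → V) : Prop where
  tree : ∀ l, IsRainbowTree φ (x l) (P l)
  inter : ∀ l m, l ≠ m → ∀ e ∈ treeEdges (x l) (P l), e ∈ treeEdges (x m) (P m) → e = s(x l, x m)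
  leaf : ∀ l m, l ≠ m → ∀ v, v ≠ x l → P l v ≠ x m
  card : ∀ l, (deep (x l) (P l)).card + 2 * (conflicts x P l).card ≤ 2 * (k - 1)

lemma IsSystem.card_dirty_le {φ : Sym2 V → C} {x : Fin k → V} {P : Fin k → V → V}
    (hS : IsSystem φ x P) {i j : Fin k} (hij : j ∈ conflicts x P i) :
    (dirty (x i) (P i)).card ≤ 4 * (k - 2) := by
  have h1 := RainbowTrees.card_dirty_le (x i) (P i)
  have h2 := hS.card i
  have h3 : 0 < (conflicts x P i).card := Finset.card_pos.2 ⟨j, hij⟩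
  omega

/-- Choice of the leaf exchanged with `x j` in the tree `i`. -/
lemma exists_first [DecidableEq C] {φ : Sym2 V → C} {M : C → V → V} (hM : IsMate φ M)
    {x : Fin k → V} {P : Fin k → V → V} (hx : Function.Injective x) (hS : IsSystem φ x P)
    {i j : Fin k} (hij : j ∈ conflicts x P i) (hcard : k + 13 * (k - 2) < Fintype.card V) :
    ∃ y, (∀ l, y ≠ x l) ∧ y ∉ dirty (x i) (P i) ∧
      (∀ l, M (φ s(y, x i)) (x j) ≠ x l) ∧ M (φ s(y, x i)) (x j) ∉ dirty (x j) (P j) ∧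
      (∀ l, l ≠ i → l ≠ j → s(x j, M (φ s(y, x i)) (x j)) ∉ treeEdges (x l) (P l)) ∧
      (∀ l, M (φ s(x j, x i)) y ≠ x l) ∧
      (∀ l, l ≠ i → l ≠ j → s(y, M (φ s(x j, x i)) y) ∉ treeEdges (x l) (P l)) := by
  have hne : j ≠ i := by
    simp only [conflicts, Finset.mem_filter] at hij; exact hij.2.1
  let O : Finset (Fin k) := (Finset.univ.erase i).erase j
  have hO : ∀ l, l ≠ i → l ≠ j → l ∈ O := fun l h h' => by simp [O, h, h']
  have hOc : O.card = k - 2 := by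
    rw [Finset.card_erase_of_mem (by simp [hne]), Finset.card_erase_of_mem (by simp)]
    simp; omega
  let W : Finset V := O.image x ∪ dirty (x j) (P j) ∪ O.image fun l => P l (x j)
  let B : Finset V := Finset.univ.image x ∪ dirty (x i) (P i) ∪
    W.image (fun w => M (φ s(x j, w)) (x i)) ∪ O.image (fun l => M (φ s(x j, x i)) (x l)) ∪
    O.biUnion (fun l => colorEnds φ (x l) (P l) (φ s(x j, x i)))
  have hW : W.card ≤ 6 * (k - 2) := by
    have h1 := Finset.card_union_le (O.image x ∪ dirty (x j) (P j)) (O.image fun l => P l (x j))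
    have h2 := Finset.card_union_le (O.image x) (dirty (x j) (P j))
    have h3 : (O.image x).card ≤ O.card := Finset.card_image_le
    have h4 : (O.image fun l => P l (x j)).card ≤ O.card := Finset.card_image_le
    have h5 := hS.card_dirty_le (mem_conflicts_comm.1 hij)
    have h6 : W.card ≤ (O.image x ∪ dirty (x j) (P j)).card +
      (O.image fun l => P l (x j)).card := h1
    omega
  have hB : B.card < (Finset.univ : Finset V).card := by
    have h1 : (Finset.univ.image x).card ≤ k :=
      Finset.card_image_le.trans (by simp)
    have h2 := hS.card_dirty_le hij
    have h3 : (W.image (fun w => M (φ s(x j, w)) (x i))).card ≤ W.card := Finset.card_image_le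
    have h4 : (O.image (fun l => M (φ s(x j, x i)) (x l))).card ≤ O.card := Finset.card_image_le
    have h5 : (O.biUnion (fun l => colorEnds φ (x l) (P l) (φ s(x j, x i)))).card ≤ O.card * 2 :=
      Finset.card_biUnion_le_card_mul _ _ _ fun l _ => card_colorEnds_le (hS.tree l) _
    rw [Finset.card_univ]
    refine lt_of_le_of_lt ?_ hcard
    refine (Finset.card_union_le _ _).trans ?_
    refine (Nat.add_le_add_right (Finset.card_union_le _ _) _).trans ?_
    refine (Nat.add_le_add_right (Nat.add_le_add_right (Finset.card_union_le _ _) _) _).trans ?_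
    refine (Nat.add_le_add_right (Nat.add_le_add_right
      (Nat.add_le_add_right (Finset.card_union_le _ _) _) _) _).trans ?_
    omega
  obtain ⟨y, -, hy⟩ := Finset.exists_mem_notMem_of_card_lt_card hB
  simp only [B, Finset.mem_union, not_or] at hy
  obtain ⟨⟨⟨⟨hy1, hy2⟩, hy3⟩, hy4⟩, hy5⟩ := hy
  have hyx : ∀ l, y ≠ x l := fun l e => hy1 (by simp [e])
  have hyW : M (φ s(y, x i)) (x j) ∉ W := fun h =>
    hy3 (Finset.mem_image.2 ⟨_, h, hM.eq_mate _ (hyx i)⟩)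
  have hxij : x j ≠ x i := hx.ne hne
  simp only [W, Finset.mem_union, not_or, Finset.mem_image, not_exists, not_and] at hyW
  obtain ⟨⟨hw1, hw2⟩, hw3⟩ := hyW
  have hw : ∀ l, M (φ s(y, x i)) (x j) ≠ x l := by
    intro l e
    by_cases hli : l = i
    · subst hli
      have h := hM.eq_mate (x j) (hyx l)
      rw [e, Sym2.eq_swap, hM.eq _ _ hxij.symm] at h
      exact hyx j h.symm
    by_cases hlj : l = j
    · exact hM.ne _ _ (e.trans (by rw [hlj]))
    · exact hw1 l (hO l hli hlj) e.symm
  refine ⟨y, hyx, hy2, hw, hw2, ?_, ?_, ?_⟩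
  · rintro l hli hlj ⟨v, hv, e⟩
    rcases Sym2.eq_iff.1 e with ⟨rfl, e'⟩ | ⟨e', -⟩
    · exact hw3 l (hO l hli hlj) e'.symm
    · exact hS.leaf l j hlj v hv e'.symm
  · intro l e
    have h : M (φ s(x j, x i)) (x l) = y := by rw [← e, hM.symm]
    by_cases hli : l = i
    · rw [hli, Sym2.eq_swap, hM.eq _ _ hxij.symm] at h
      exact hyx j h.symm
    by_cases hlj : l = j
    · rw [hlj, hM.eq _ _ hxij] at h
      exact hyx i h.symm
    · exact hy4 (Finset.mem_image.2 ⟨l, hO l hli hlj, h⟩)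
  · intro l hli hlj h
    exact hy5 (Finset.mem_biUnion.2 ⟨l, hO l hli hlj, mem_colorEnds h (hM.color _ _)⟩)

/-- Choice of the leaf exchanged with `w` in the tree `j`. -/
lemma exists_second [DecidableEq C] {φ : Sym2 V → C} {M : C → V → V} (hM : IsMate φ M)
    {x : Fin k → V} {P : Fin k → V → V} (hT : ∀ l, IsRainbowTree φ (x l) (P l))
    (hdeep : ∀ l, (deep (x l) (P l)).card ≤ 2 * (k - 1)) {i j : Fin k} (hij : i ≠ j)
    (hdirty : (dirty (x j) (P j)).card ≤ 4 * (k - 2)) {w : V} (hw : ∀ l, w ≠ x l)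
    (hcard : k + 1 + 6 * (k - 2) + 2 * (k - 1) + 2 * (k - 1) * (k - 1) < Fintype.card V) :
    ∃ v, (∀ l, v ≠ x l) ∧ v ≠ w ∧ v ∉ dirty (x j) (P j) ∧
      (∀ l, M (φ s(v, x j)) w ≠ x l) ∧ (∀ l, M (φ s(w, x j)) v ≠ x l) ∧
      (∀ l, l ≠ j → s(w, M (φ s(v, x j)) w) ∉ treeEdges (x l) (P l)) ∧
      (∀ l, l ≠ i → l ≠ j → s(v, M (φ s(w, x j)) v) ∉ treeEdges (x l) (P l)) := by
  let N : Finset (Fin k) := Finset.univ.erase j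
  let O : Finset (Fin k) := N.erase i
  have hN : ∀ l, l ≠ j → l ∈ N := fun l h => by simp [N, h]
  have hNc : N.card = k - 1 := by
    rw [Finset.card_erase_of_mem (by simp)]; simp
  have hO : ∀ l, l ≠ i → l ≠ j → l ∈ O := fun l h h' => by simp [O, N, h, h']
  have hOc : O.card = k - 2 := by
    rw [Finset.card_erase_of_mem (by simp [N, hij]), hNc]; omega
  let U : Finset V := N.image x ∪ N.biUnion fun l => deepNeighbors (x l) (P l) w
  let B : Finset V := insert w (Finset.univ.image x) ∪ dirty (x j) (P j) ∪
    U.image (fun u => M (φ s(w, u)) (x j)) ∪ N.image (fun l => M (φ s(w, x j)) (x l)) ∪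
    O.biUnion (fun l => colorEnds φ (x l) (P l) (φ s(w, x j)))
  have hU : U.card ≤ (k - 1) + 2 * (k - 1) * (k - 1) := by
    have h1 : (N.image x).card ≤ N.card := Finset.card_image_le
    have h2 : (N.biUnion fun l => deepNeighbors (x l) (P l) w).card ≤ N.card * (2 * (k - 1)) :=
      Finset.card_biUnion_le_card_mul _ _ _ fun l _ => Finset.card_image_le.trans (hdeep l)
    refine (Finset.card_union_le _ _).trans ?_
    rw [hNc] at h1 h2
    rw [mul_comm (k - 1)] at h2
    omega
  have hB : B.card < (Finset.univ : Finset V).card := by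
    have h1 : (insert w (Finset.univ.image x)).card ≤ k + 1 :=
      (Finset.card_insert_le _ _).trans
        (Nat.add_le_add_right (Finset.card_image_le.trans (by simp)) 1)
    have h3 : (U.image (fun u => M (φ s(w, u)) (x j))).card ≤ U.card := Finset.card_image_le
    have h4 : (N.image (fun l => M (φ s(w, x j)) (x l))).card ≤ N.card := Finset.card_image_le
    have h5 : (O.biUnion (fun l => colorEnds φ (x l) (P l) (φ s(w, x j)))).card ≤ O.card * 2 :=
      Finset.card_biUnion_le_card_mul _ _ _ fun l _ => card_colorEnds_le (hT l) _
    rw [Finset.card_univ]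
    refine lt_of_le_of_lt ?_ hcard
    refine (Finset.card_union_le _ _).trans ?_
    refine (Nat.add_le_add_right (Finset.card_union_le _ _) _).trans ?_
    refine (Nat.add_le_add_right (Nat.add_le_add_right (Finset.card_union_le _ _) _) _).trans ?_
    refine (Nat.add_le_add_right (Nat.add_le_add_right
      (Nat.add_le_add_right (Finset.card_union_le _ _) _) _) _).trans ?_
    omega
  obtain ⟨v, -, hv⟩ := Finset.exists_mem_notMem_of_card_lt_card hB
  simp only [B, Finset.mem_union, Finset.mem_insert, not_or] at hv
  obtain ⟨⟨⟨⟨⟨hvw, hv1⟩, hv2⟩, hv3⟩, hv4⟩, hv5⟩ := hv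
  have hvx : ∀ l, v ≠ x l := fun l e => hv1 (by simp [e])
  have hvU : M (φ s(v, x j)) w ∉ U := fun h =>
    hv3 (Finset.mem_image.2 ⟨_, h, hM.eq_mate _ (hvx j)⟩)
  simp only [U, Finset.mem_union, not_or, Finset.mem_image, Finset.mem_biUnion, not_exists,
    not_and] at hvU
  have hu : ∀ l, M (φ s(v, x j)) w ≠ x l := by
    intro l e
    by_cases hlj : l = j
    · have h := hM.eq_mate w (hvx j)
      rw [e, hlj, Sym2.eq_swap, hM.eq _ _ (hw j).symm] at h
      exact hvw h.symm
    · exact hvU.1 l (hN l hlj) e.symm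
  refine ⟨v, hvx, hvw, hv2, hu, ?_, ?_, ?_⟩
  · intro l e
    have h : M (φ s(w, x j)) (x l) = v := by rw [← e, hM.symm]
    by_cases hlj : l = j
    · rw [hlj, Sym2.eq_swap, hM.eq _ _ (hw j).symm] at h
      exact hvw h.symm
    · exact hv4 (Finset.mem_image.2 ⟨l, hN l hlj, h⟩)
  · intro l hlj h
    exact hvU.2 l (hN l hlj) (mem_deepNeighbors (hT l) (hw l) (hu l) h)
  · intro l hli hlj h
    exact hv5 (Finset.mem_biUnion.2 ⟨l, hO l hli hlj, mem_colorEnds h (hM.color _ _)⟩)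

/-- One conflict can be removed from a system. -/
lemma IsSystem.exists_fewer_conflicts [DecidableEq C] {φ : Sym2 V → C} {M : C → V → V}
    (hM : IsMate φ M) {x : Fin k → V} {P : Fin k → V → V} (hx : Function.Injective x)
    (hS : IsSystem φ x P) {i j : Fin k} (hij : j ∈ conflicts x P i)
    (hcard₁ : k + 13 * (k - 2) < Fintype.card V)
    (hcard₂ : k + 1 + 6 * (k - 2) + 2 * (k - 1) + 2 * (k - 1) * (k - 1) < Fintype.card V) :
    ∃ P' : Fin k → V → V, IsSystem φ x P' ∧
      ∑ l, (conflicts x P' l).card < ∑ l, (conflicts x P l).card := by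
  obtain ⟨y, hy, hyd, hw, hwd, hwE, hz, hzE⟩ := exists_first hM hx hS hij hcard₁
  set w := M (φ s(y, x i)) (x j)
  set z := M (φ s(x j, x i)) y
  have hji := mem_conflicts_comm.1 hij
  obtain ⟨hne, hPi, hPj⟩ : j ≠ i ∧ P i (x j) = x i ∧ P j (x i) = x j := by
    simpa [conflicts] using hij
  have hxij : x j ≠ x i := hx.ne hne
  set Q := swap φ M (x i) (P i) (x j) y with hQ
  have hQtree : IsRainbowTree φ (x i) Q :=
    (hS.tree i).swap hM hxij (hy i) (hy j).symm hPi (eq_root_of_notMem_dirty (hy i) hyd)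
      (hS.leaf i j hne.symm) (ne_of_notMem_dirty (hy i) hyd)
  have hQdeep := card_deep_swap_le φ M (x i) (P i) (x j) y
  rw [← hQ] at hQdeep
  set P₁ := Function.update P i Q with hP₁
  have hP₁i : P₁ i = Q := by simp [hP₁]
  have hP₁n : ∀ l, l ≠ i → P₁ l = P l := fun l h => by simp [hP₁, h]
  have hci : 0 < (conflicts x P i).card := Finset.card_pos.2 ⟨j, hij⟩
  obtain ⟨v, hv, hvw, hvd, hu, ht, huE, htE⟩ := exists_second (x := x) (P := P₁) hM
    (fun l => by
      by_cases h : l = i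
      · subst h; rw [hP₁i]; exact hQtree
      · rw [hP₁n l h]; exact hS.tree l)
    (fun l => by
      have := hS.card l
      by_cases h : l = i
      · subst h; rw [hP₁i]; omega
      · rw [hP₁n l h]; omega) hne.symm
    (by rw [hP₁n j hne]; exact hS.card_dirty_le hji) hw hcard₂
  rw [hP₁n j hne] at hvd
  set u := M (φ s(v, x j)) w
  set t := M (φ s(w, x j)) v
  set R := swap φ M (x j) (P j) w v with hR
  have hRtree : IsRainbowTree φ (x j) R :=
    (hS.tree j).swap hM (hw j) (hv j) hvw.symm (eq_root_of_notMem_dirty (hw j) hwd)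
      (eq_root_of_notMem_dirty (hv j) hvd) (ne_of_notMem_dirty (hw j) hwd)
      (ne_of_notMem_dirty (hv j) hvd)
  have hRdeep := card_deep_swap_le φ M (x j) (P j) w v
  rw [← hR] at hRdeep
  have hQx : Q (x j) = w := swap_left (hy j).symm
  have hQy : Q y = z := swap_right
  have hQo : ∀ a, a ≠ x j → a ≠ y → Q a = P i a := fun a h h' => swap_of_ne h h'
  have hRw : R w = u := swap_left hvw.symm
  have hRv : R v = t := swap_right
  have hRo : ∀ a, a ≠ w → a ≠ v → R a = P j a := fun a h h' => swap_of_ne h h'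
  have hQE : ∀ e ∈ treeEdges (x i) Q, e ∈ treeEdges (x i) (P i) ∨ e = s(x j, w) ∨ e = s(y, z) :=
    fun e he => mem_treeEdges_swap (hy j).symm he
  have hRE : ∀ e ∈ treeEdges (x j) R, e ∈ treeEdges (x j) (P j) ∨ e = s(w, u) ∨ e = s(v, t) :=
    fun e he => mem_treeEdges_swap hvw.symm he
  have hwR : s(x j, w) ∉ treeEdges (x j) R := by
    rintro ⟨a, ha, e⟩
    rcases Sym2.eq_iff.1 e with ⟨e', -⟩ | ⟨e', haw⟩
    · exact ha e'.symm
    · rw [← haw, hRw] at e'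
      exact hu j e'.symm
  have hzR : s(y, z) ∉ treeEdges (x j) R := by
    intro h
    have hRx : R (x i) = x j := by rw [hRo _ (hw i).symm (hv i).symm, hPj]
    have e := hRtree.eq_of_mem hxij.symm h (by rw [hM.color, hRx, Sym2.eq_swap])
    rw [hRx] at e
    rcases Sym2.eq_iff.1 e with ⟨e', -⟩ | ⟨e', -⟩
    · exact hy _ e'
    · exact hy _ e'
  have htQ : s(v, t) ∉ treeEdges (x i) Q := by
    intro h
    have e := hQtree.eq_of_mem hxij h (by rw [hM.color, hQx, Sym2.eq_swap])
    rw [hQx] at e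
    rcases Sym2.eq_iff.1 e with ⟨e', -⟩ | ⟨e', -⟩
    · exact hv _ e'
    · exact hvw e'
  have huQ : s(w, u) ∉ treeEdges (x i) Q := by
    have := huE i hne.symm
    rwa [hP₁i] at this
  set P₂ := Function.update P₁ j R with hP₂
  have hP₂i : P₂ i = Q := by simp [hP₂, hP₁i, hne.symm]
  have hP₂j : P₂ j = R := by simp [hP₂]
  have hP₂n : ∀ l, l ≠ i → l ≠ j → P₂ l = P l := fun l h h' => by simp [hP₂, hP₁, h, h']
  have hroot : ∀ l m, (l ≠ i ∨ m ≠ j) → P₂ l (x m) = P l (x m) := by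
    intro l m h
    by_cases hli : l = i
    · subst hli
      rw [hP₂i, hQo _ (hx.ne (by tauto)) (hy m).symm]
    by_cases hlj : l = j
    · subst hlj
      rw [hP₂j, hRo _ (hw m).symm (hv m).symm]
    · rw [hP₂n l hli hlj]
  have hsub : ∀ l, conflicts x P₂ l ⊆ conflicts x P l := by
    intro l m hm
    simp only [conflicts, Finset.mem_filter, Finset.mem_univ, true_and] at hm ⊢
    by_cases h1 : l = i ∧ m = j
    · rw [h1.1, h1.2]; exact ⟨hne, hPi, hPj⟩
    by_cases h2 : m = i ∧ l = j
    · rw [h2.1, h2.2]; exact ⟨hne.symm, hPj, hPi⟩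
    · rwa [hroot l m (by tauto), hroot m l (by tauto)] at hm
  have hnot : j ∉ conflicts x P₂ i := by
    simp only [conflicts, Finset.mem_filter, Finset.mem_univ, true_and, not_and]
    intro _ h
    rw [hP₂i, hQx] at h
    exact absurd h (hw i)
  have hlt_i : (conflicts x P₂ i).card < (conflicts x P i).card :=
    Finset.card_lt_card ⟨hsub i, fun h => hnot (h hij)⟩
  have hlt_j : (conflicts x P₂ j).card < (conflicts x P j).card :=
    Finset.card_lt_card ⟨hsub j, fun h => hnot (mem_conflicts_comm.2 (h hji))⟩
  have inter_i : ∀ l, l ≠ i → l ≠ j → ∀ e ∈ treeEdges (x i) Q, e ∈ treeEdges (x l) (P l) →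
      e = s(x i, x l) := by
    intro l hli hlj e he he'
    rcases hQE e he with h | rfl | rfl
    · exact hS.inter i l hli.symm e h he'
    · exact absurd he' (hwE l hli hlj)
    · exact absurd he' (hzE l hli hlj)
  have inter_j : ∀ l, l ≠ i → l ≠ j → ∀ e ∈ treeEdges (x j) R, e ∈ treeEdges (x l) (P l) →
      e = s(x j, x l) := by
    intro l hli hlj e he he'
    rcases hRE e he with h | rfl | rfl
    · exact hS.inter j l hlj.symm e h he'
    · exact absurd he' (by have := huE l hlj; rwa [hP₁n l hli] at this)
    · exact absurd he' (by have := htE l hli hlj; rwa [hP₁n l hli] at this)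
  have inter_ij : ∀ e ∈ treeEdges (x i) Q, e ∈ treeEdges (x j) R → e = s(x i, x j) := by
    intro e he he'
    rcases hQE e he with h | rfl | rfl
    · rcases hRE e he' with h' | rfl | rfl
      · exact hS.inter i j hne.symm e h h'
      · exact absurd he huQ
      · exact absurd he htQ
    · exact absurd he' hwR
    · exact absurd he' hzR
  refine ⟨P₂, ⟨?_, ?_, ?_, ?_⟩, ?_⟩
  · intro l
    by_cases hli : l = i
    · subst hli; rwa [hP₂i]
    by_cases hlj : l = j
    · subst hlj; rwa [hP₂j]
    · rw [hP₂n l hli hlj]; exact hS.tree l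
  · intro l m hlm e he he'
    by_cases hli : l = i
    · subst hli
      rw [hP₂i] at he
      by_cases hmj : m = j
      · subst hmj
        rw [hP₂j] at he'
        exact inter_ij e he he'
      · rw [hP₂n m hlm.symm hmj] at he'
        exact inter_i m hlm.symm hmj e he he'
    by_cases hlj : l = j
    · subst hlj
      rw [hP₂j] at he
      by_cases hmi : m = i
      · subst hmi
        rw [hP₂i] at he'
        rw [Sym2.eq_swap]
        exact inter_ij e he' he
      · rw [hP₂n m hmi hlm.symm] at he'
        exact inter_j m hmi hlm.symm e he he'
    rw [hP₂n l hli hlj] at he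
    by_cases hmi : m = i
    · subst hmi
      rw [hP₂i] at he'
      rw [Sym2.eq_swap]
      exact inter_i l hli hlj e he' he
    by_cases hmj : m = j
    · subst hmj
      rw [hP₂j] at he'
      rw [Sym2.eq_swap]
      exact inter_j l hli hlj e he' he
    rw [hP₂n m hmi hmj] at he'
    exact hS.inter l m hlm e he he'
  · intro l m hlm a ha
    by_cases hli : l = i
    · subst hli
      rw [hP₂i]
      by_cases h1 : a = x j
      · rw [h1, hQx]; exact hw m
      by_cases h2 : a = y
      · rw [h2, hQy]; exact hz m
      rw [hQo a h1 h2]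
      exact hS.leaf l m hlm a ha
    by_cases hlj : l = j
    · subst hlj
      rw [hP₂j]
      by_cases h1 : a = w
      · rw [h1, hRw]; exact hu m
      by_cases h2 : a = v
      · rw [h2, hRv]; exact ht m
      rw [hRo a h1 h2]
      exact hS.leaf l m hlm a ha
    rw [hP₂n l hli hlj]
    exact hS.leaf l m hlm a ha
  · intro l
    have h := hS.card l
    by_cases hli : l = i
    · subst hli
      rw [hP₂i]
      omega
    by_cases hlj : l = j
    · subst hlj
      rw [hP₂j]
      omega
    rw [hP₂n l hli hlj]
    have := Finset.card_le_card (hsub l)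
    omega
  · exact Finset.sum_lt_sum (fun l _ => Finset.card_le_card (hsub l)) ⟨i, Finset.mem_univ i, hlt_i⟩

/-- The stars at distinct vertices form a system. -/
lemma isSystem_stars {φ : Sym2 V → C} {M : C → V → V} (hM : IsMate φ M) {x : Fin k → V}
    (hx : Function.Injective x) : IsSystem φ x fun l _ => x l := by
  refine ⟨fun l => ⟨⟨fun v => if v = x l then 0 else 1, fun v hv => by simp [hv]⟩, ?_⟩, ?_, ?_, ?_⟩
  · intro u v hu hv e
    rw [Sym2.eq_swap, Sym2.eq_swap (a := v)] at e
    exact hM.eq_of_color hu.symm hv.symm e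
  · rintro l m hlm e ⟨v, hv, rfl⟩ ⟨v', hv', e⟩
    rcases Sym2.eq_iff.1 e with ⟨-, h⟩ | ⟨h, -⟩
    · exact absurd h (hx.ne hlm)
    · change s(v, x l) = _
      rw [h, Sym2.eq_swap]
  · exact fun l m hlm v _ => hx.ne hlm
  · intro l
    have h1 : deep (x l) (fun _ => x l) = ∅ := by simp [deep]
    have h2 : (conflicts x (fun l _ => x l) l).card ≤ k - 1 := by
      have : conflicts x (fun l _ => x l) l ⊆ Finset.univ.erase l := by
        intro m hm
        simp only [conflicts, Finset.mem_filter] at hm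
        simp [hm.2.1]
      refine (Finset.card_le_card this).trans ?_
      rw [Finset.card_erase_of_mem (by simp)]
      simp
    rw [h1, Finset.card_empty]
    omega

lemma IsSystem.exists_no_conflicts [DecidableEq C] {φ : Sym2 V → C} {M : C → V → V}
    (hM : IsMate φ M) {x : Fin k → V} (hx : Function.Injective x)
    (hcard₁ : 2 ≤ k → k + 13 * (k - 2) < Fintype.card V)
    (hcard₂ : 2 ≤ k →
      k + 1 + 6 * (k - 2) + 2 * (k - 1) + 2 * (k - 1) * (k - 1) < Fintype.card V) (n : ℕ) :
    ∀ P : Fin k → V → V, IsSystem φ x P → ∑ l, (conflicts x P l).card = n →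
      ∃ P', IsSystem φ x P' ∧ ∀ l, conflicts x P' l = ∅ := by
  induction n using Nat.strong_induction_on with
  | _ n ih =>
    intro P hS hn
    by_cases h : ∀ l, conflicts x P l = ∅
    · exact ⟨P, hS, h⟩
    · push Not at h
      obtain ⟨i, j, hij⟩ := h
      have hne : j ≠ i := by
        simp only [conflicts, Finset.mem_filter] at hij; exact hij.2.1
      have hk : 2 ≤ k := by
        have := i.2; have := j.2; have := Fin.val_ne_of_ne hne; omega
      obtain ⟨P', hS', hlt⟩ := hS.exists_fewer_conflicts hM hx hij (hcard₁ hk) (hcard₂ hk)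
      exact ih _ (hn ▸ hlt) P' hS' rfl

lemma IsSystem.disjoint {φ : Sym2 V → C} {x : Fin k → V} {P : Fin k → V → V}
    (hS : IsSystem φ x P) (hP : ∀ l, conflicts x P l = ∅)
    {l m : Fin k} (hlm : l ≠ m) :
    Disjoint (treeEdges (x l) (P l)) (treeEdges (x m) (P m)) := by
  have root : ∀ l m, l ≠ m → s(x l, x m) ∈ treeEdges (x l) (P l) → P l (x m) = x l := by
    rintro l m hlm ⟨v, hv, e⟩
    rcases Sym2.eq_iff.1 e with ⟨e', -⟩ | ⟨h, h'⟩
    · exact absurd e'.symm hv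
    · rw [h', ← h]
  rw [Set.disjoint_left]
  intro e he he'
  obtain rfl := hS.inter l m hlm e he he'
  have hm : m ∈ conflicts x P l := by
    simp only [conflicts, Finset.mem_filter, Finset.mem_univ, true_and]
    refine ⟨hlm.symm, root l m hlm he, root m l hlm.symm ?_⟩
    rwa [Sym2.eq_swap]
  simp [hP l] at hm

end System

/-- In a proper colouring of the complete graph with one colour fewer than vertices, every colour
occurs at every vertex. -/
lemma exists_isMate {n : ℕ} {φ : Sym2 (Fin n) → Fin (n - 1)} (hφ : ProperEdgeColoring φ) :
    ∃ M, IsMate φ M := by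
  have key : ∀ (c : Fin (n - 1)) (v : Fin n), ∃ u, u ≠ v ∧ φ s(v, u) = c := by
    intro c v
    let f : {u : Fin n // u ≠ v} → Fin (n - 1) := fun u => φ s(v, u.1)
    have hf : Function.Injective f := by
      intro a b e
      by_contra h
      exact hφ v a.1 b.1 a.2.symm b.2.symm (fun h' => h (Subtype.ext h')) e
    have hb : Function.Bijective f := by
      rw [Fintype.bijective_iff_injective_and_card]
      exact ⟨hf, by simp [Fintype.card_subtype_compl]⟩
    obtain ⟨u, hu⟩ := hb.2 c
    exact ⟨u.1, u.2, hu⟩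
  choose M hM using key
  refine ⟨M, fun c v => (hM c v).1, fun c v => (hM c v).2, fun u v huv => ?_⟩
  by_contra h
  exact hφ u _ v (hM _ u).1.symm huv h (hM _ u).2

lemma three_mul_sq_le_of_floor (m : ℕ) :
    3 * ⌊Real.sqrt (6 * (m : ℝ) + 9) / 3⌋₊ ^ 2 ≤ 2 * m + 3 := by
  set k := ⌊Real.sqrt (6 * (m : ℝ) + 9) / 3⌋₊
  have h1 : (k : ℝ) ≤ Real.sqrt (6 * (m : ℝ) + 9) / 3 := Nat.floor_le (by positivity)
  have h2 : 3 * (k : ℝ) ≤ Real.sqrt (6 * (m : ℝ) + 9) := by linarith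
  have h3 := (Real.le_sqrt (by positivity) (by positivity)).1 h2
  have h4 : 3 * (k : ℝ) ^ 2 ≤ 2 * m + 3 := by nlinarith
  exact_mod_cast h4

end RainbowTrees

open RainbowTrees

/-- If `m ≥ 1` and `φ` is a proper `(2m-1)`-edge-coloring of
`K_{2m}`, then `K_{2m}` contains at least `⌊√(6m+9)/3⌋` pairwise edge-disjoint
rainbow spanning trees. -/
theorem statement0 (m : ℕ) (hm : 1 ≤ m)
    (φ : Sym2 (Fin (2 * m)) → Fin (2 * m - 1))
    (hφ : ProperEdgeColoring φ) :
    ∃ T : Fin (⌊Real.sqrt (6 * (m : ℝ) + 9) / 3⌋₊) → SimpleGraph (Fin (2 * m)),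
      (∀ i, (T i).IsTree) ∧
      (∀ i, Set.InjOn φ (T i).edgeSet) ∧
      (∀ i j, i ≠ j → Disjoint (T i).edgeSet (T j).edgeSet) := by
  obtain ⟨M, hM⟩ := exists_isMate hφ
  have hk := three_mul_sq_le_of_floor m
  set k := ⌊Real.sqrt (6 * (m : ℝ) + 9) / 3⌋₊
  have hle : k ≤ 2 * m := by
    rcases Nat.lt_or_ge k 2 with h | h
    · omega
    · nlinarith
  have hx : Function.Injective (Fin.castLE hle) := Fin.castLE_injective hle
  obtain ⟨P, hS, hP⟩ := IsSystem.exists_no_conflicts hM hx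
    (fun h => by
      obtain ⟨s, hs⟩ := Nat.exists_eq_add_of_le' h
      rw [hs] at hk
      rw [Fintype.card_fin, hs, Nat.add_sub_cancel]
      nlinarith [sq_nonneg ((s : ℤ) - 1)])
    (fun h => by
      obtain ⟨s, hs⟩ := Nat.exists_eq_add_of_le' h
      rw [hs] at hk
      rw [Fintype.card_fin, hs, Nat.add_sub_cancel, show s + 2 - 1 = s + 1 by omega]
      rcases Nat.eq_zero_or_pos s with rfl | h0
      · omega
      · nlinarith) _ _ (isSystem_stars hM hx) rfl
  refine ⟨fun l => SimpleGraph.fromEdgeSet (treeEdges (Fin.castLE hle l) (P l)),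
    fun l => (hS.tree l).isTree.1, fun l => ?_, fun l l' hl => ?_⟩
  · rw [(hS.tree l).isTree.2]
    rintro e ⟨u, hu, rfl⟩ e' he' hc
    exact ((hS.tree l).eq_of_mem hu he' hc.symm).symm
  · rw [(hS.tree l).isTree.2, (hS.tree l').isTree.2]
    exact hS.disjoint hP hl
end

section
/- Let m ≥ 1 be an integer, let φ be a proper (2m−1)-edge-coloring of K_{2m}, and let k be an integer with 1 ≤ k ≤ ⌊√(6m+9)/3⌋. Then there exist k pairwise edge-disjoint rainbow spanning trees T_1, …, T_k of K_{2m} together with designated roots r_1, …, r_k satisfying condition f(k). -/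
/-- The number of leaves (degree-1 vertices) of `G` that are adjacent to `v`. -/
noncomputable def leavesAdj {V : Type*} (G : SimpleGraph V) (v : V) : ℕ :=
  {x | G.Adj v x ∧ (G.neighborSet x).ncard = 1}.ncard

/-- Condition `f(k)` for trees `T 0, …, T (k-1)` (thought of as `T_1, …, T_k`)
with designated roots `r 0, …, r (k-1)`:
the roots are pairwise distinct; `r_1` has degree `(2m-1) - 2(k-1)` in `T_1` and at
least `(2m-1) - 4(k-1)` of its neighbors in `T_1` are leaves; and for `2 ≤ i ≤ k`,
`r_i` has degree `(2m-1) - i - 2(k-i)` in `T_i` and at least `(2m-1) - 2i - 4(k-i)`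
of its neighbors in `T_i` are leaves. -/
def CondF (m k : ℕ) (T : Fin k → SimpleGraph (Fin (2 * m)))
    (r : Fin k → Fin (2 * m)) : Prop :=
  Function.Injective r ∧
  (∀ i : Fin k, (i : ℕ) = 0 →
    (((T i).neighborSet (r i)).ncard : ℤ) = 2 * (m : ℤ) - 1 - 2 * ((k : ℤ) - 1) ∧
    (leavesAdj (T i) (r i) : ℤ) ≥ 2 * (m : ℤ) - 1 - 4 * ((k : ℤ) - 1)) ∧
  (∀ i : Fin k, 1 ≤ (i : ℕ) →
    (((T i).neighborSet (r i)).ncard : ℤ) =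
      2 * (m : ℤ) - 1 - ((i : ℤ) + 1) - 2 * ((k : ℤ) - ((i : ℤ) + 1)) ∧
    (leavesAdj (T i) (r i) : ℤ) ≥
      2 * (m : ℤ) - 1 - 2 * ((i : ℤ) + 1) - 4 * ((k : ℤ) - ((i : ℤ) + 1)))

namespace RainbowTrees

open Finset

variable {n c : ℕ}

/-- `x` is a leaf of `G` whose only neighbor is `v`. -/
def IsLeafAt {V : Type*} (G : SimpleGraph V) (v x : V) : Prop :=
  G.Adj v x ∧ (G.neighborSet x).ncard = 1

theorem IsLeafAt.eq_of_adj {V : Type*} {G : SimpleGraph V} {v x p : V} (h : IsLeafAt G v x)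
    (hp : G.Adj x p) : p = v := by
  obtain ⟨a, ha⟩ := Set.ncard_eq_one.mp h.2
  have h1 : p ∈ G.neighborSet x := hp
  have h2 : v ∈ G.neighborSet x := h.1.symm
  rw [ha] at h1 h2
  exact h1.trans h2.symm

theorem isLeafAt_of_forall {V : Type*} {G : SimpleGraph V} {v x : V} (h : G.Adj v x)
    (hx : ∀ p, G.Adj x p → p = v) : IsLeafAt G v x := by
  refine ⟨h, Set.ncard_eq_one.mpr ⟨v, Set.ext fun p => ⟨fun hp => hx p hp, ?_⟩⟩⟩
  rintro rfl
  exact h.symm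

/-- In a proper coloring with `n - 1` colors every vertex sees every color exactly once. -/
theorem exists_colorNeighbor {φ : Sym2 (Fin n) → Fin (n - 1)} (hφ : ProperEdgeColoring φ) :
    ∃ nb : Fin n → Fin (n - 1) → Fin n, ∀ a e b, (b ≠ a ∧ φ s(a, b) = e) ↔ b = nb a e := by
  have key : ∀ a e, ∃ b, b ≠ a ∧ φ s(a, b) = e := by
    intro a e
    have hinj : Set.InjOn (fun b => φ s(a, b)) (univ.erase a : Finset (Fin n)) := by
      intro b hb b' hb' h
      by_contra hne
      exact hφ a b b' (by simpa [eq_comm] using hb) (by simpa [eq_comm] using hb') hne h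
    have hcard : ((univ.erase a).image fun b => φ s(a, b)).card = Fintype.card (Fin (n - 1)) := by
      rw [card_image_of_injOn hinj]
      simp
    have he : e ∈ (univ.erase a).image fun b => φ s(a, b) := by
      rw [(card_eq_iff_eq_univ _).mp hcard]
      exact mem_univ e
    simpa using he
  choose nb h1 h2 using key
  refine ⟨nb, fun a e b => ⟨fun ⟨hb, he⟩ => ?_, ?_⟩⟩
  · by_contra hne
    exact hφ a b (nb a e) hb.symm (h1 a e).symm hne (he.trans (h2 a e).symm)
  · rintro rfl
    exact ⟨h1 a e, h2 a e⟩

theorem isTree_of_connected_of_ncard_le {G : SimpleGraph (Fin n)} (hG : G.Connected)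
    (h : G.edgeSet.ncard + 1 ≤ n) : G.IsTree := by
  have h1 := hG.card_vert_le_card_edgeSet_add_one
  rw [SimpleGraph.isTree_iff_connected_and_card]
  refine ⟨hG, ?_⟩
  rw [Nat.card_coe_set_eq] at *
  simp only [Nat.card_eq_fintype_card, Fintype.card_fin] at *
  omega

theorem ncard_edgeSet_of_isTree {G : SimpleGraph (Fin n)} (hG : G.IsTree) :
    G.edgeSet.ncard + 1 = n := by
  have h := (SimpleGraph.isTree_iff_connected_and_card.mp hG).2
  rw [Nat.card_coe_set_eq] at h
  simpa using h

/-- Reattaching a leaf `x` from `r` to `v` preserves being a tree. -/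
theorem isTree_moveLeaf {G : SimpleGraph (Fin n)} (hG : G.IsTree) {x r v : Fin n}
    (hx : IsLeafAt G r x) (hv : v ≠ x) :
    (SimpleGraph.fromEdgeSet (G.edgeSet \ {s(x, r)} ∪ {s(x, v)})).IsTree := by
  set H := SimpleGraph.fromEdgeSet (G.edgeSet \ {s(x, r)} ∪ {s(x, v)}) with hH
  have hrx : r ≠ x := hx.1.ne
  have hxv : H.Adj x v := by simp [hH, hv.symm]
  have hadj : ∀ a b, a ≠ x → b ≠ x → G.Adj a b → H.Adj a b := by
    intro a b ha hb hab
    simp [hH, hab, hab.ne, ha, hb]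
  have hwalk : ∀ a b : Fin n, G.Reachable a b →
      H.Reachable (if a = x then r else a) (if b = x then r else b) := by
    rintro a b ⟨w⟩
    induction w with
    | nil => exact SimpleGraph.Reachable.refl _
    | @cons a b d hab _ ih =>
      refine SimpleGraph.Reachable.trans ?_ ih
      by_cases ha : a = x
      · subst ha
        obtain rfl := hx.eq_of_adj hab
        simp [hrx]
      · by_cases hb : b = x
        · subst hb
          obtain rfl := hx.eq_of_adj hab.symm
          simp [ha]
        · simpa [ha, hb] using (hadj a b ha hb hab).reachable
  have hreach : ∀ a, H.Reachable a v := by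
    intro a
    by_cases ha : a = x
    · exact ha ▸ hxv.reachable
    · simpa [ha, hv] using hwalk a v (hG.connected.preconnected a v)
  have hconn : H.Connected :=
    { preconnected := fun a b => (hreach a).trans (hreach b).symm
      nonempty := ⟨x⟩ }
  refine isTree_of_connected_of_ncard_le hconn ?_
  have hn := ncard_edgeSet_of_isTree hG
  have hmem : s(x, r) ∈ G.edgeSet := hx.1.symm
  have h1 : H.edgeSet ⊆ insert s(x, v) (G.edgeSet \ {s(x, r)}) := by
    intro e he
    simp only [hH, SimpleGraph.edgeSet_fromEdgeSet] at he
    simpa [or_comm] using he.1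
  have h2 := Set.ncard_le_ncard h1 (Set.toFinite _)
  have h3 := Set.ncard_insert_le s(x, v) (G.edgeSet \ {s(x, r)})
  have h4 := Set.ncard_sdiff_singleton_add_one hmem (Set.toFinite _)
  omega

/-- Exchanging the attachment colors of two leaves at the same vertex of a rainbow spanning tree
yields another rainbow spanning tree. -/
theorem exists_switch {φ : Sym2 (Fin n) → Fin c} (hφ : ProperEdgeColoring φ)
    {G : SimpleGraph (Fin n)} (hG : G.IsTree) (hrb : Set.InjOn φ G.edgeSet)
    {x y r v w : Fin n} (hx : IsLeafAt G r x) (hy : IsLeafAt G r y) (hxy : x ≠ y)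
    (hvx : v ≠ x) (hwy : w ≠ y) (hv : φ s(x, v) = φ s(r, y)) (hw : φ s(y, w) = φ s(x, r)) :
    ∃ H : SimpleGraph (Fin n), H.IsTree ∧ Set.InjOn φ H.edgeSet ∧
      (∀ e ∈ H.edgeSet, (e ∈ G.edgeSet ∧ e ≠ s(x, r)) ∨ e = s(x, v) ∨ e = s(y, w)) ∧
      (H.neighborSet r).ncard + 2 = (G.neighborSet r).ncard ∧
      leavesAdj G r ≤ leavesAdj H r + 4 := by
  have hrx : r ≠ x := hx.1.ne
  have hry : r ≠ y := hy.1.ne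
  have hcol : φ s(r, x) ≠ φ s(r, y) := hφ r x y hrx hry hxy
  have hvr : v ≠ r := by
    rintro rfl
    exact hcol (by rw [← hv, Sym2.eq_swap])
  have hwr : w ≠ r := by
    rintro rfl
    exact hcol (by rw [Sym2.eq_swap, ← hw, Sym2.eq_swap])
  have hvy : v ≠ y := by
    rintro rfl
    exact hφ v x r hvx hry.symm hrx.symm (by rw [Sym2.eq_swap, hv, Sym2.eq_swap])
  have hG1 := isTree_moveLeaf hG hx hvx
  set G1 := SimpleGraph.fromEdgeSet (G.edgeSet \ {s(x, r)} ∪ {s(x, v)}) with hG1def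
  have hadj1 : ∀ a b, G1.Adj a b ↔ (G.Adj a b ∧ s(a, b) ≠ s(x, r)) ∨ s(a, b) = s(x, v) := by
    intro a b
    simp only [hG1def, SimpleGraph.fromEdgeSet_adj, Set.mem_union, Set.mem_sdiff,
      SimpleGraph.mem_edgeSet, Set.mem_singleton_iff]
    constructor
    · exact fun h => h.1
    · intro h
      refine ⟨h, ?_⟩
      rintro rfl
      rcases h with h | h
      · exact h.1.ne rfl
      · simp only [Sym2.eq_iff] at h
        grind
  have hy1 : IsLeafAt G1 r y := by
    refine isLeafAt_of_forall ((hadj1 _ _).2 (Or.inl ⟨hy.1, ?_⟩)) fun p hp => ?_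
    · simp only [ne_eq, Sym2.eq_iff]; grind
    · rcases (hadj1 _ _).1 hp with h | h
      · exact hy.eq_of_adj h.1
      · simp only [Sym2.eq_iff] at h; grind
  have hH := isTree_moveLeaf hG1 hy1 hwy
  set H := SimpleGraph.fromEdgeSet (G1.edgeSet \ {s(y, r)} ∪ {s(y, w)}) with hHdef
  have hadj : ∀ a b, H.Adj a b ↔ (G.Adj a b ∧ s(a, b) ≠ s(x, r) ∧ s(a, b) ≠ s(y, r)) ∨
      s(a, b) = s(x, v) ∨ s(a, b) = s(y, w) := by
    intro a b
    simp only [hHdef, SimpleGraph.fromEdgeSet_adj, Set.mem_union, Set.mem_sdiff,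
      SimpleGraph.mem_edgeSet, Set.mem_singleton_iff, hadj1]
    constructor
    · grind
    · intro h
      refine ⟨?_, ?_⟩
      · rcases h with h | h | h
        · exact Or.inl ⟨Or.inl ⟨h.1, h.2.1⟩, h.2.2⟩
        · refine Or.inl ⟨Or.inr h, ?_⟩
          rw [h]
          simp only [Sym2.eq_iff]; grind
        · exact Or.inr h
      · rintro rfl
        rcases h with h | h | h
        · exact h.1.ne rfl
        all_goals
          simp only [Sym2.eq_iff] at h
          grind
  refine ⟨H, hH, ?_, ?_, ?_, ?_⟩
  · have hxr : s(x, r) ∈ G.edgeSet := hx.1.symm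
    have hyr : s(y, r) ∈ G.edgeSet := hy.1.symm
    have hv' : φ s(x, v) = φ s(y, r) := by rw [hv, Sym2.eq_swap]
    have hcol' : φ s(x, r) ≠ φ s(y, r) := by
      rwa [Sym2.eq_swap, Sym2.eq_swap (a := y)]
    have hmem : ∀ e ∈ H.edgeSet, (e ∈ G.edgeSet ∧ e ≠ s(x, r) ∧ e ≠ s(y, r)) ∨
        e = s(x, v) ∨ e = s(y, w) := by
      rintro ⟨a, b⟩ he
      exact (hadj a b).1 he
    intro e he f hf hef
    have h1 := fun g (hg : g ∈ G.edgeSet) => hrb hg hxr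
    have h2 := fun g (hg : g ∈ G.edgeSet) => hrb hg hyr
    rcases hmem e he with h | h | h <;> rcases hmem f hf with h' | h' | h'
    · exact hrb h.1 h'.1 hef
    all_goals grind
  · rintro ⟨a, b⟩ he
    rcases (hadj a b).1 he with h | h
    · exact Or.inl ⟨h.1, h.2.1⟩
    · exact Or.inr h
  · have hset : H.neighborSet r = (G.neighborSet r \ {x}) \ {y} := by
      ext p
      simp only [SimpleGraph.mem_neighborSet, hadj, Set.mem_sdiff, Set.mem_singleton_iff,
        ne_eq, Sym2.eq_iff]
      grind
    have h1 := Set.ncard_sdiff_singleton_add_one (s := G.neighborSet r) (a := x) hx.1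
      (Set.toFinite _)
    have h2 := Set.ncard_sdiff_singleton_add_one (s := G.neighborSet r \ {x}) (a := y)
      ⟨hy.1, hxy.symm⟩ (Set.toFinite _)
    rw [hset]
    omega
  · have hsub : {p | G.Adj r p ∧ (G.neighborSet p).ncard = 1} ⊆
        {p | H.Adj r p ∧ (H.neighborSet p).ncard = 1} ∪
          (({x, y, v, w} : Finset (Fin n)) : Set (Fin n)) := by
      intro p hp
      by_cases hpm : p ∈ ({x, y, v, w} : Finset (Fin n))
      · exact Or.inr hpm
      · simp only [Finset.mem_insert, Finset.mem_singleton, not_or] at hpm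
        have hp' : IsLeafAt G r p := hp
        refine Or.inl (isLeafAt_of_forall ?_ fun q hq => ?_)
        · rw [hadj]
          refine Or.inl ⟨hp.1, ?_⟩
          simp only [ne_eq, Sym2.eq_iff]; grind
        · rw [hadj] at hq
          simp only [Sym2.eq_iff] at hq
          rcases hq with h | h | h
          · exact hp'.eq_of_adj h.1
          all_goals grind
    have h1 := Set.ncard_le_ncard hsub (Set.toFinite _)
    have h2 := Set.ncard_union_le {p | H.Adj r p ∧ (H.neighborSet p).ncard = 1}
      (({x, y, v, w} : Finset (Fin n)) : Set (Fin n))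
    rw [Set.ncard_coe_finset] at h2
    have h3 : ({x, y, v, w} : Finset (Fin n)).card ≤ 4 := Finset.card_le_four
    simp only [leavesAdj]
    omega

/-- Reattaching `k + 1` leaves of a star, whose edge colors get permuted, yields a rainbow spanning
tree. -/
theorem exists_modifiedStar {φ : Sym2 (Fin n) → Fin c} (hφ : ProperEdgeColoring φ) (k : ℕ)
    {x : Fin n} {s z : ℕ → Fin n} {σ : ℕ → ℕ} (hsx : ∀ i ≤ k, s i ≠ x)
    (hs : ∀ i ≤ k, ∀ j ≤ k, s i = s j → i = j) (hzx : ∀ i ≤ k, z i ≠ x)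
    (hz : ∀ i ≤ k, ∀ j ≤ i, z i ≠ s j) (hσk : ∀ i ≤ k, σ i ≤ k)
    (hσ : ∀ i ≤ k, ∀ j ≤ k, σ i = σ j → i = j)
    (hcol : ∀ i ≤ k, φ s(s i, z i) = φ s(x, s (σ i))) :
    ∃ H : SimpleGraph (Fin n), H.IsTree ∧ Set.InjOn φ H.edgeSet ∧
      (∀ e ∈ H.edgeSet, (∃ p, p ≠ x ∧ (∀ i ≤ k, p ≠ s i) ∧ e = s(x, p)) ∨
        ∃ i ≤ k, e = s(s i, z i)) ∧
      (H.neighborSet x).ncard + (k + 1) + 1 = n ∧ n ≤ leavesAdj H x + 2 * (k + 1) + 1 := by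
  set S : Finset (Fin n) := (range (k + 1)).image s with hS
  set P : Finset (Fin n) := univ.erase x \ S with hP
  have hScard : S.card = k + 1 := by
    rw [hS, card_image_of_injOn, card_range]
    intro i hi j hj h
    simp only [coe_range, Set.mem_Iio] at hi hj
    exact hs i (by omega) j (by omega) h
  have hmemP : ∀ p, p ∈ P ↔ p ≠ x ∧ ∀ i ≤ k, p ≠ s i := by
    intro p
    simp only [hP, hS, mem_sdiff, mem_erase, mem_univ, and_true, mem_image, mem_range, not_exists,
      not_and, Nat.lt_succ_iff]
    exact and_congr_right fun _ => forall₂_congr fun i _ => ne_comm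
  have hPcard : P.card + (k + 1) + 1 = n := by
    have hsub : S ⊆ univ.erase x := by
      intro p hp
      simp only [hS, mem_image, mem_range] at hp
      obtain ⟨i, hi, rfl⟩ := hp
      simpa using hsx i (by omega)
    have h1 := card_sdiff_add_card_eq_card hsub
    have h2 := card_erase_add_one (mem_univ x)
    simp only [card_univ, Fintype.card_fin] at h2
    rw [hP]
    omega
  set E : Finset (Sym2 (Fin n)) :=
    P.image (fun p => s(x, p)) ∪ (range (k + 1)).image (fun i => s(s i, z i)) with hE
  have hmemE : ∀ e, e ∈ E ↔ (∃ p ∈ P, e = s(x, p)) ∨ ∃ i ≤ k, e = s(s i, z i) := by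
    intro e
    simp only [hE, mem_union, mem_image, mem_range, Nat.lt_succ_iff, eq_comm]
  set H := SimpleGraph.fromEdgeSet (E : Set (Sym2 (Fin n))) with hH
  have hedge : ∀ e ∈ H.edgeSet, (∃ p ∈ P, e = s(x, p)) ∨ ∃ i ≤ k, e = s(s i, z i) := by
    intro e he
    rw [hH, SimpleGraph.edgeSet_fromEdgeSet] at he
    exact (hmemE e).1 he.1
  have hadjP : ∀ p ∈ P, H.Adj x p := by
    intro p hp
    rw [hH, SimpleGraph.fromEdgeSet_adj]
    exact ⟨(hmemE _).2 (Or.inl ⟨p, hp, rfl⟩), ((hmemP p).1 hp).1.symm⟩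
  have hadjS : ∀ i ≤ k, H.Adj (s i) (z i) := by
    intro i hi
    rw [hH, SimpleGraph.fromEdgeSet_adj]
    exact ⟨(hmemE _).2 (Or.inr ⟨i, hi, rfl⟩), (hz i hi i le_rfl).symm⟩
  have hreachS : ∀ d i, i ≤ k → k - i = d → H.Reachable (s i) x := by
    intro d
    induction d using Nat.strong_induction_on with
    | _ d ih =>
      intro i hi hd
      refine (hadjS i hi).reachable.trans ?_
      by_cases h : z i ∈ P
      · exact (hadjP _ h).symm.reachable
      · have : ∃ j ≤ k, z i = s j := by
          by_contra! hcon
          exact h ((hmemP _).2 ⟨hzx i hi, hcon⟩)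
        obtain ⟨j, hj, hzj⟩ := this
        have hij : i < j := by
          by_contra hji
          exact hz i hi j (by omega) hzj
        rw [hzj]
        exact ih (k - j) (by omega) j hj rfl
  have hreach : ∀ a, H.Reachable a x := by
    intro a
    by_cases hax : a = x
    · rw [hax]
    · by_cases h : a ∈ P
      · exact (hadjP _ h).symm.reachable
      · have : ∃ j ≤ k, a = s j := by
          by_contra! hcon
          exact h ((hmemP _).2 ⟨hax, hcon⟩)
        obtain ⟨j, hj, rfl⟩ := this
        exact hreachS _ j hj rfl
  have hconn : H.Connected :=
    { preconnected := fun a b => (hreach a).trans (hreach b).symm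
      nonempty := ⟨x⟩ }
  have hadjx : ∀ p, H.Adj x p → p ∈ P := by
    intro p hp
    rcases hedge s(x, p) hp with ⟨q, hq, h⟩ | ⟨i, hi, h⟩
    · simp only [Sym2.eq_iff] at h
      have := (hmemP q).1 hq
      grind
    · have := hsx i hi
      have := hzx i hi
      simp only [Sym2.eq_iff] at h
      grind
  refine ⟨H, isTree_of_connected_of_ncard_le hconn ?_, ?_, ?_, ?_, ?_⟩
  · have h1 : H.edgeSet ⊆ (E : Set (Sym2 (Fin n))) := by
      rw [hH, SimpleGraph.edgeSet_fromEdgeSet]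
      exact Set.sdiff_subset
    have h2 := Set.ncard_le_ncard h1 (Set.toFinite _)
    rw [Set.ncard_coe_finset] at h2
    have h3 : E.card ≤ P.card + (k + 1) :=
      (card_union_le _ _).trans
        (Nat.add_le_add card_image_le (card_image_le.trans (card_range _).le))
    omega
  · have hinj : ∀ p q, p ≠ x → q ≠ x → φ s(x, p) = φ s(x, q) → p = q := by
      intro p q hp hq h
      by_contra hne
      exact hφ x p q hp.symm hq.symm hne h
    intro e he f hf hef
    rcases hedge e he with ⟨p, hp, rfl⟩ | ⟨i, hi, rfl⟩ <;>
      rcases hedge f hf with ⟨q, hq, rfl⟩ | ⟨j, hj, rfl⟩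
    · rw [hinj p q ((hmemP p).1 hp).1 ((hmemP q).1 hq).1 hef]
    · rw [hcol j hj] at hef
      exact absurd (hinj p _ ((hmemP p).1 hp).1 (hsx _ (hσk j hj)) hef)
        (((hmemP p).1 hp).2 _ (hσk j hj))
    · rw [hcol i hi] at hef
      exact absurd (hinj q _ ((hmemP q).1 hq).1 (hsx _ (hσk i hi)) hef.symm)
        (((hmemP q).1 hq).2 _ (hσk i hi))
    · rw [hcol i hi, hcol j hj] at hef
      have := hs _ (hσk i hi) _ (hσk j hj)
        (hinj _ _ (hsx _ (hσk i hi)) (hsx _ (hσk j hj)) hef)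
      rw [hσ i hi j hj this]
  · intro e he
    rcases hedge e he with ⟨p, hp, h⟩ | h
    · exact Or.inl ⟨p, ((hmemP p).1 hp).1, ((hmemP p).1 hp).2, h⟩
    · exact Or.inr h
  · have hset : H.neighborSet x = (P : Set (Fin n)) :=
      Set.ext fun p => ⟨hadjx p, hadjP p⟩
    rw [hset, Set.ncard_coe_finset]
    exact hPcard
  · have hsub : ((P \ (range (k + 1)).image z : Finset (Fin n)) : Set (Fin n)) ⊆
        {p | H.Adj x p ∧ (H.neighborSet p).ncard = 1} := by
      intro p hp
      simp only [coe_sdiff, coe_image, coe_range, Set.mem_sdiff, mem_coe, Set.mem_image,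
        Set.mem_Iio, not_exists, not_and, Nat.lt_succ_iff] at hp
      refine isLeafAt_of_forall (hadjP p hp.1) fun q hq => ?_
      have hpP := (hmemP p).1 hp.1
      rcases hedge s(p, q) hq with ⟨t, -, h⟩ | ⟨i, hi, h⟩
      · simp only [Sym2.eq_iff] at h
        grind
      · have := hp.2 i hi
        have := hpP.2 i hi
        simp only [Sym2.eq_iff] at h
        grind
    have h1 := Set.ncard_le_ncard hsub (Set.toFinite _)
    rw [Set.ncard_coe_finset] at h1
    have h2 := le_card_sdiff ((range (k + 1)).image z) P
    have h3 : ((range (k + 1)).image z).card ≤ k + 1 := card_image_le.trans (card_range _).le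
    simp only [leavesAdj]
    omega

/-- The number of edges missing at the root of the `i`-th of `k` trees. -/
def degreeDefect (i k : ℕ) : ℕ :=
  if i = 0 then 2 * (k - 1) else i + 1 + 2 * (k - (i + 1))

/-- The `k` pairwise edge-disjoint rainbow spanning trees `T 0, …, T (k - 1)` rooted at
`r 0, …, r (k - 1)` satisfy the degree and leaf bounds of `CondF`. -/
structure IsPacking (φ : Sym2 (Fin n) → Fin c) (k : ℕ) (T : ℕ → SimpleGraph (Fin n))
    (r : ℕ → Fin n) : Prop where
  isTree : ∀ i < k, (T i).IsTree
  rainbow : ∀ i < k, Set.InjOn φ (T i).edgeSet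
  disjoint : ∀ i < k, ∀ j < k, i ≠ j → ∀ e ∈ (T i).edgeSet, e ∉ (T j).edgeSet
  root_inj : ∀ i < k, ∀ j < k, r i = r j → i = j
  degree : ∀ i < k, ((T i).neighborSet (r i)).ncard + degreeDefect i k + 1 = n
  leaves : ∀ i < k, n ≤ leavesAdj (T i) (r i) + 2 * degreeDefect i k + 1

open Classical in
theorem card_filter_isLeafAt (G : SimpleGraph (Fin n)) (r : Fin n) :
    (univ.filter fun x => IsLeafAt G r x).card = leavesAdj G r := by
  rw [leavesAdj, ← Set.ncard_coe_finset]
  congr 1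
  ext x
  simp [IsLeafAt]

theorem sum_range_defect_le (k : ℕ) : ∑ i ∈ range k, (2 * degreeDefect i k + 1) ≤ 3 * k ^ 2 := by
  have h1 : ∀ i ∈ range k, 2 * degreeDefect i k + 1 ≤ 2 * k + (2 * (k - 1 - i) + 1) := by
    intro i hi
    have := mem_range.mp hi
    unfold degreeDefect
    split <;> omega
  refine (sum_le_sum h1).trans ?_
  rw [sum_add_distrib, sum_range_reflect (fun i => 2 * i + 1) k]
  have h2 : ∀ k, ∑ i ∈ range k, (2 * i + 1) = k ^ 2 := by
    intro k
    induction k with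
    | zero => simp
    | succ k ih => rw [sum_range_succ, ih]; ring
  rw [h2]
  simp only [sum_const, card_range, smul_eq_mul]
  exact le_of_eq (by ring)

/-- If there are enough vertices, two of them are leaves at the root in every tree of a packing. -/
theorem IsPacking.exists_common_leaves {φ : Sym2 (Fin n) → Fin c} {k : ℕ}
    {T : ℕ → SimpleGraph (Fin n)} {r : ℕ → Fin n} (h : IsPacking φ k T r)
    (hn : 3 * k ^ 2 + 2 ≤ n) :
    ∃ x u, x ≠ u ∧ (∀ i < k, IsLeafAt (T i) (r i) x) ∧ ∀ i < k, IsLeafAt (T i) (r i) u := by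
  classical
  set B : Finset (Fin n) := (range k).biUnion fun i => univ.filter fun x => ¬IsLeafAt (T i) (r i) x
    with hB
  have hBcard : B.card ≤ 3 * k ^ 2 := by
    refine card_biUnion_le.trans (le_trans (sum_le_sum fun i hi => ?_) (sum_range_defect_le k))
    have h1 := card_filter_isLeafAt (T i) (r i)
    have h2 := card_filter_add_card_filter_not (s := (univ : Finset (Fin n)))
      fun x => IsLeafAt (T i) (r i) x
    have h3 := h.leaves i (mem_range.mp hi)
    simp only [card_univ, Fintype.card_fin] at h2
    omega
  have hmem : ∀ x ∈ Bᶜ, ∀ i < k, IsLeafAt (T i) (r i) x := by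
    intro x hx i hi
    simp only [hB, mem_compl, mem_biUnion, mem_range, mem_filter, mem_univ, true_and,
      not_exists, not_and, not_not] at hx
    exact hx i hi
  have hlt : 1 < Bᶜ.card := by
    rw [card_compl, Fintype.card_fin]
    omega
  obtain ⟨x, hx, u, hu, hxu⟩ := one_lt_card.mp hlt
  exact ⟨x, u, hxu, hmem x hx, hmem u hu⟩

/-- Finite sequences can be built one entry at a time. -/
theorem exists_sequence {α : Type*} (k : ℕ) (a : α) (P : ℕ → (ℕ → α) → α → Prop)
    (hcongr : ∀ i s s' v, (∀ l ≤ i, s l = s' l) → P i s v → P i s' v)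
    (hstep : ∀ i < k, ∀ s, s 0 = a → (∀ j < i, P j s (s (j + 1))) → ∃ v, P i s v) :
    ∃ s : ℕ → α, s 0 = a ∧ ∀ i < k, P i s (s (i + 1)) := by
  have key : ∀ i ≤ k, ∃ s : ℕ → α, s 0 = a ∧ ∀ j < i, P j s (s (j + 1)) := by
    intro i
    induction i with
    | zero => exact fun _ => ⟨fun _ => a, rfl, by simp⟩
    | succ i ih =>
      intro hi
      obtain ⟨s, hs0, hs⟩ := ih (by omega)
      obtain ⟨v, hv⟩ := hstep i (by omega) s hs0 hs
      refine ⟨Function.update s (i + 1) v, by simpa using hs0, fun j hj => ?_⟩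
      have hagree : ∀ l ≤ j, s l = Function.update s (i + 1) v l := fun l hl => by
        rw [Function.update_of_ne (by omega)]
      refine hcongr j s _ _ hagree ?_
      rcases Nat.lt_succ_iff_lt_or_eq.mp hj with hj | rfl
      · rw [Function.update_of_ne (by omega)]
        exact hs j hj
      · rwa [Function.update_self]
  exact key k le_rfl

/-- A rainbow graph has at most one edge of each color, hence at most two vertices meet it. -/
theorem card_filter_adj_le_two {φ : Sym2 (Fin n) → Fin c} {G : SimpleGraph (Fin n)}
    (hG : Set.InjOn φ G.edgeSet) (e : Fin c) {f : Fin n → Fin n} (hf : ∀ v, φ s(v, f v) = e)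
    [DecidablePred fun v => G.Adj v (f v)] :
    (univ.filter fun v => G.Adj v (f v)).card ≤ 2 := by
  by_cases hne : ∃ v, G.Adj v (f v)
  · obtain ⟨v, hv⟩ := hne
    refine le_trans (card_le_card (t := {v, f v}) fun w hw => ?_) card_le_two
    have hw' : G.Adj w (f w) := (mem_filter.mp hw).2
    have := hG (x₁ := s(w, f w)) (x₂ := s(v, f v)) hw' hv ((hf w).trans (hf v).symm)
    simp only [Sym2.eq_iff] at this
    simp only [mem_insert, mem_singleton]
    tauto
  · rw [filter_eq_empty_iff.mpr fun v _ hv => hne ⟨v, hv⟩]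
    simp

theorem exists_mem_avoiding {α β : Type*} [DecidableEq α] [DecidableEq β] {A B : Finset α}
    {S : Finset β} {f : α → β} (hf : Set.InjOn f A) (h : B.card + S.card < A.card) :
    ∃ a ∈ A, a ∉ B ∧ f a ∉ S := by
  by_contra! hcon
  have hsub : A \ B ⊆ A.filter fun a => f a ∈ S := by
    intro a ha
    rw [mem_sdiff] at ha
    exact mem_filter.mpr ⟨ha.1, hcon a ha.1 ha.2⟩
  have h1 : (A.filter fun a => f a ∈ S).card ≤ S.card :=
    card_le_card_of_injOn f (fun a ha => (mem_filter.mp ha).2)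
      (hf.mono fun a ha => (mem_filter.mp ha).1)
  have h2 := card_le_card hsub
  have h3 := le_card_sdiff B A
  omega

/-- The vertex sequence along which a packing is extended: `s 0` is a common leaf `u`, and `s (i+1)`
is the new neighbor of `x` in the `i`-th tree. -/
theorem IsPacking.exists_sequence {φ : Sym2 (Fin n) → Fin (n - 1)} {k : ℕ}
    {T : ℕ → SimpleGraph (Fin n)} {r : ℕ → Fin n} (h : IsPacking φ k T r)
    {nb : Fin n → Fin (n - 1) → Fin n} (hnb : ∀ a e b, (b ≠ a ∧ φ s(a, b) = e) ↔ b = nb a e)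
    (hn : 8 * k + 4 * (k - 1) + 1 < n) {x u : Fin n} :
    ∃ s : ℕ → Fin n, s 0 = u ∧ ∀ i < k, s (i + 1) ≠ x ∧
      (∀ l ≤ i, s (i + 1) ≠ s l) ∧ (∀ j < k, s (i + 1) ≠ r j) ∧
      (∀ l ≤ i, s (i + 1) ≠ nb (s l) (φ s(x, s i))) ∧
      (∀ j < k, ¬(T j).Adj (s (i + 1)) (nb (s (i + 1)) (φ s(x, s i)))) ∧
      (∀ j < k, s (i + 1) ≠ nb x (φ s(u, r j))) ∧
      ∃ y, IsLeafAt (T i) (r i) y ∧ φ s(x, s (i + 1)) = φ s(r i, y) ∧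
        ∀ j < k, ¬(T j).Adj y (nb y (φ s(x, r i))) := by
  classical
  refine RainbowTrees.exists_sequence k u (fun i s v => v ≠ x ∧
      (∀ l ≤ i, v ≠ s l) ∧ (∀ j < k, v ≠ r j) ∧
      (∀ l ≤ i, v ≠ nb (s l) (φ s(x, s i))) ∧
      (∀ j < k, ¬(T j).Adj v (nb v (φ s(x, s i)))) ∧
      (∀ j < k, v ≠ nb x (φ s(u, r j))) ∧
      ∃ y, IsLeafAt (T i) (r i) y ∧ φ s(x, v) = φ s(r i, y) ∧
        ∀ j < k, ¬(T j).Adj y (nb y (φ s(x, r i)))) ?_ ?_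
  · rintro i s s' v hss ⟨h1, h2, h3, h4, h5, h6⟩
    refine ⟨h1, fun l hl => hss l hl ▸ h2 l hl, h3, fun l hl => ?_, ?_, h6⟩
    · rw [← hss l hl, ← hss i le_rfl]
      exact h4 l hl
    · rw [← hss i le_rfl]
      exact h5
  · intro i hi s _ _
    have hnbc : ∀ e v, φ s(v, nb v e) = e := fun e v => ((hnb v e _).2 rfl).2
    set A : Finset (Fin n) := univ.filter fun y => IsLeafAt (T i) (r i) y with hA
    have hAcard : 8 * k < A.card := by
      rw [hA, card_filter_isLeafAt]
      have h1 := h.leaves i hi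
      have h2 : degreeDefect i k ≤ 2 * (k - 1) := by
        unfold degreeDefect
        split <;> omega
      omega
    set badEdge : Fin (n - 1) → Finset (Fin n) := fun e =>
      (range k).biUnion fun j => univ.filter fun v => (T j).Adj v (nb v e) with hbad
    have hbadcard : ∀ e, (badEdge e).card ≤ k * 2 := by
      intro e
      refine (card_biUnion_le_card_mul _ _ 2 fun j hj => ?_).trans (by rw [card_range])
      exact card_filter_adj_le_two (h.rainbow j (mem_range.mp hj)) e (hnbc e)
    have hbadmem : ∀ e v, v ∉ badEdge e → ∀ j < k, ¬(T j).Adj v (nb v e) := by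
      intro e v hv j hj hadj
      exact hv (mem_biUnion.mpr ⟨j, mem_range.mpr hj, mem_filter.mpr ⟨mem_univ _, hadj⟩⟩)
    have himage : ∀ (f : ℕ → Fin n) (m : ℕ), m ≤ k → ((range m).image f).card ≤ k := fun f m hm =>
      card_image_le.trans ((card_range m).le.trans hm)
    have himagemem : ∀ (f : ℕ → Fin n) (m : ℕ) v, v ∉ (range m).image f → ∀ l < m, v ≠ f l := by
      rintro f m v hv l hl rfl
      exact hv (mem_image_of_mem f (mem_range.mpr hl))
    set S1 := (range (i + 1)).image s
    set S2 := (range k).image r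
    set S3 := (range (i + 1)).image fun l => nb (s l) (φ s(x, s i))
    set S4 := badEdge (φ s(x, s i))
    set S5 := (range k).image fun j => nb x (φ s(u, r j))
    have hScard : (S1 ∪ (S2 ∪ (S3 ∪ (S4 ∪ S5)))).card ≤ 6 * k := by
      have h1 : S1.card ≤ k := himage _ _ hi
      have h2 : S2.card ≤ k := himage _ _ le_rfl
      have h3 : S3.card ≤ k := himage _ _ hi
      have h4 : S4.card ≤ k * 2 := hbadcard _
      have h5 : S5.card ≤ k := himage _ _ le_rfl
      have := card_union_le S1 (S2 ∪ (S3 ∪ (S4 ∪ S5)))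
      have := card_union_le S2 (S3 ∪ (S4 ∪ S5))
      have := card_union_le S3 (S4 ∪ S5)
      have := card_union_le S4 S5
      omega
    have hinj : Set.InjOn (fun y => nb x (φ s(r i, y))) (A : Set (Fin n)) := by
      intro y hy y' hy' heq
      have hyA : IsLeafAt (T i) (r i) y := (mem_filter.mp hy).2
      have hyA' : IsLeafAt (T i) (r i) y' := (mem_filter.mp hy').2
      have hc : φ s(r i, y) = φ s(r i, y') := by
        rw [← hnbc (φ s(r i, y)) x, ← hnbc (φ s(r i, y')) x]
        exact congrArg (fun v => φ s(x, v)) heq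
      rw [(hnb (r i) _ y).1 ⟨hyA.1.ne', rfl⟩, (hnb (r i) _ y').1 ⟨hyA'.1.ne', rfl⟩, hc]
    obtain ⟨y, hyA, hyB, hyS⟩ := exists_mem_avoiding (B := badEdge (φ s(x, r i)))
      (S := S1 ∪ (S2 ∪ (S3 ∪ (S4 ∪ S5)))) hinj (by
        have := hbadcard (φ s(x, r i))
        omega)
    simp only [mem_union, not_or] at hyS
    obtain ⟨hy1, hy2, hy3, hy4, hy5⟩ := hyS
    exact ⟨nb x (φ s(r i, y)), ((hnb _ _ _).2 rfl).1,
      fun l hl => himagemem _ _ _ hy1 l (by omega), himagemem _ _ _ hy2,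
      fun l hl => himagemem _ _ _ hy3 l (by omega), hbadmem _ _ hy4, himagemem _ _ _ hy5,
      y, (mem_filter.mp hyA).2, hnbc _ _, hbadmem _ _ hyB⟩

theorem degreeDefect_succ {i k : ℕ} (h : i < k) :
    degreeDefect i (k + 1) = degreeDefect i k + 2 := by
  unfold degreeDefect
  split <;> omega

theorem IsPacking.exists_succ {φ : Sym2 (Fin n) → Fin (n - 1)} (hφ : ProperEdgeColoring φ) {k : ℕ}
    (hk : 1 ≤ k) {T : ℕ → SimpleGraph (Fin n)} {r : ℕ → Fin n} (h : IsPacking φ k T r)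
    (hn : 3 * k ^ 2 + 2 ≤ n) (hn' : 8 * k + 4 * (k - 1) + 1 < n) :
    ∃ T' r', IsPacking φ (k + 1) T' r' := by
  obtain ⟨nb, hnb⟩ := exists_colorNeighbor hφ
  obtain ⟨x, u, hxu, hx, hu⟩ := h.exists_common_leaves hn
  obtain ⟨s, hs0, hs⟩ := h.exists_sequence hnb hn' (x := x) (u := u)
  have hnbc : ∀ v e, φ s(v, nb v e) = e := fun v e => ((hnb v e _).2 rfl).2
  have hnbne : ∀ v e, nb v e ≠ v := fun v e => ((hnb v e _).2 rfl).1
  have hcancel : ∀ a b b', b ≠ a → b' ≠ a → φ s(a, b) = φ s(a, b') → b = b' :=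
    fun a b b' hb hb' he => ((hnb a _ b).1 ⟨hb, he⟩).trans ((hnb a _ b').1 ⟨hb', rfl⟩).symm
  have hsx : ∀ i ≤ k, s i ≠ x := by
    rintro (_ | i) hi
    · rw [hs0]; exact hxu.symm
    · exact (hs i hi).1
  have hsr : ∀ i ≤ k, ∀ j < k, s i ≠ r j := by
    rintro (_ | i) hi j hj
    · rw [hs0]; exact (hu j hj).1.ne'
    · exact (hs i hi).2.2.1 j hj
  have hslt : ∀ i ≤ k, ∀ j < i, s i ≠ s j := by
    rintro (_ | i) hi j hj
    · omega
    · exact (hs i hi).2.1 j (by omega)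
  have hsinj : ∀ i ≤ k, ∀ j ≤ k, s i = s j → i = j := by
    intro i hi j hj hij
    by_contra hne
    rcases Nat.lt_or_gt_of_ne hne with hlt | hlt
    · exact hslt j hj i hlt hij.symm
    · exact hslt i hi j hlt hij
  have hxr : ∀ i < k, x ≠ r i := fun i hi => (hx i hi).1.ne'
  set σ : ℕ → ℕ := fun i => if i = 0 then k else i - 1 with hσ
  set z : ℕ → Fin n := fun i => nb (s i) (φ s(x, s (σ i))) with hz
  have hσk : ∀ i ≤ k, σ i ≤ k := by
    intro i hi
    simp only [hσ]
    split <;> omega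
  have hσne : ∀ i ≤ k, σ i ≠ i := by
    intro i hi
    simp only [hσ]
    split <;> omega
  have hσinj : ∀ i ≤ k, ∀ j ≤ k, σ i = σ j → i = j := by
    intro i hi j hj
    simp only [hσ]
    split <;> split <;> omega
  have hzx : ∀ i ≤ k, z i ≠ x := by
    intro i hi hzi
    have h1 := hnbc (s i) (φ s(x, s (σ i)))
    change φ s(s i, z i) = _ at h1
    rw [hzi, Sym2.eq_swap] at h1
    exact hσne i hi (hsinj _ (hσk i hi) _ hi
      (hcancel _ _ _ (hsx _ hi) (hsx _ (hσk i hi)) h1).symm)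
  have hzs : ∀ i ≤ k, ∀ j ≤ i, z i ≠ s j := by
    rintro (_ | i) hi j hj hzi
    · obtain rfl : j = 0 := by omega
      exact hnbne _ _ hzi
    · rcases Nat.lt_succ_iff_lt_or_eq.mp (Nat.lt_succ_of_le hj) with hj | rfl
      · refine (hs i hi).2.2.2.1 j (by omega) ((hnb _ _ _).1 ⟨hslt _ hi j hj, ?_⟩)
        rw [← hzi, Sym2.eq_swap]
        exact hnbc _ _
      · exact hnbne _ _ hzi
  have hzT : ∀ i ≤ k, ∀ j < k, ¬(T j).Adj (s i) (z i) := by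
    rintro (_ | i) hi j hj hadj
    · rw [hs0] at hadj
      have hz0 : z 0 = r j := (hu j hj).eq_of_adj hadj
      have h1 := hnbc (s 0) (φ s(x, s (σ 0)))
      change φ s(s 0, z 0) = _ at h1
      rw [hz0, hs0] at h1
      have h2 : s k = nb x (φ s(u, r j)) := (hnb _ _ _).1 ⟨hsx k le_rfl, h1.symm⟩
      obtain ⟨l, rfl⟩ : ∃ l, k = l + 1 := ⟨k - 1, by omega⟩
      exact (hs l (by omega)).2.2.2.2.2.1 j hj h2
    · exact (hs i hi).2.2.2.2.1 j hj hadj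
  obtain ⟨H, hHtree, hHrb, hHe, hHdeg, hHleaf⟩ := exists_modifiedStar hφ k hsx hsinj hzx hzs hσk
    hσinj fun i _ => hnbc (s i) (φ s(x, s (σ i)))
  have hy : ∀ i, ∃ y, i < k → IsLeafAt (T i) (r i) y ∧ φ s(x, s (i + 1)) = φ s(r i, y) ∧
      ∀ j < k, ¬(T j).Adj y (nb y (φ s(x, r i))) := by
    intro i
    by_cases hi : i < k
    · obtain ⟨y, hy⟩ := (hs i hi).2.2.2.2.2.2
      exact ⟨y, fun _ => hy⟩
    · exact ⟨x, fun hi' => absurd hi' hi⟩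
  choose y hy using hy
  set w : ℕ → Fin n := fun i => nb (y i) (φ s(x, r i)) with hw
  have hwc : ∀ i, φ s(y i, w i) = φ s(x, r i) := fun i => hnbc _ _
  have hyx : ∀ i < k, x ≠ y i := by
    intro i hi hxy
    have h1 := (hy i hi).2.1
    rw [← hxy, Sym2.eq_swap (a := r i)] at h1
    exact hsr (i + 1) hi i hi (hcancel _ _ _ (hsx _ hi) (hxr i hi).symm h1)
  have hG : ∀ i, ∃ G : SimpleGraph (Fin n), i < k → G.IsTree ∧ Set.InjOn φ G.edgeSet ∧
      (∀ e ∈ G.edgeSet, (e ∈ (T i).edgeSet ∧ e ≠ s(x, r i)) ∨ e = s(x, s (i + 1)) ∨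
        e = s(y i, w i)) ∧
      (G.neighborSet (r i)).ncard + 2 = ((T i).neighborSet (r i)).ncard ∧
      leavesAdj (T i) (r i) ≤ leavesAdj G (r i) + 4 := by
    intro i
    by_cases hi : i < k
    · obtain ⟨G, hG⟩ := exists_switch hφ (h.isTree i hi) (h.rainbow i hi) (hx i hi) (hy i hi).1
        (hyx i hi) (hsx _ hi) (hnbne _ _) (hy i hi).2.1 (hwc i)
      exact ⟨G, fun _ => hG⟩
    · exact ⟨⊥, fun hi' => absurd hi' hi⟩
  choose G hG using hG
  have hTx : ∀ i < k, ∀ p, (T i).Adj x p → p = r i := fun i hi p hp => (hx i hi).eq_of_adj hp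
  have hsw : ∀ i ≤ k, ∀ j < k, φ s(x, s i) ≠ φ s(y j, w j) := by
    intro i hi j hj heq
    rw [hwc] at heq
    exact hsr i hi j hj (hcancel _ _ _ (hsx i hi) (hxr j hj).symm heq)
  have hGG : ∀ i < k, ∀ j < k, i ≠ j → ∀ e ∈ (G i).edgeSet, e ∉ (G j).edgeSet := by
    intro i hi j hj hij e he hf
    rcases (hG i hi).2.2.1 e he with h1 | h1 | h1 <;> rcases (hG j hj).2.2.1 e hf with h2 | h2 | h2
    · exact h.disjoint i hi j hj hij e h1.1 h2.1
    · rw [h2] at h1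
      exact hsr _ hj i hi (hTx i hi _ h1.1)
    · rw [h2] at h1
      exact (hy j hj).2.2 i hi h1.1
    · rw [h1] at h2
      exact hsr _ hi j hj (hTx j hj _ h2.1)
    · have h3 : s (i + 1) = s (j + 1) := hcancel x _ _ (hsx _ hi) (hsx _ hj) (by rw [← h1, ← h2])
      have := hsinj _ hi _ hj h3
      omega
    · exact hsw _ hi j hj (by rw [← h1, ← h2])
    · rw [h1] at h2
      exact (hy i hi).2.2 j hj h2.1
    · exact hsw _ hj i hi (by rw [← h1, ← h2])
    · have h3 : φ s(x, r i) = φ s(x, r j) := by rw [← hwc, ← hwc, ← h1, ← h2]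
      exact hij (h.root_inj i hi j hj (hcancel _ _ _ (hxr i hi).symm (hxr j hj).symm h3))
  have hGH : ∀ i < k, ∀ e ∈ (G i).edgeSet, e ∉ H.edgeSet := by
    intro i hi e he hf
    rcases (hG i hi).2.2.1 e he with h1 | h1 | h1 <;>
      rcases hHe e hf with ⟨p, hpx, hps, h2⟩ | ⟨l, hl, h2⟩
    · rw [h2] at h1
      exact h1.2 (by rw [hTx i hi p h1.1])
    · rw [h2] at h1
      exact hzT l hl i hi h1.1
    · rw [h1] at h2
      exact hps _ hi (hcancel x _ _ hpx (hsx _ hi) (by rw [← h2]))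
    · rw [h1, Sym2.eq_iff] at h2
      rcases h2 with h2 | h2
      · exact hsx l hl h2.1.symm
      · exact hzx l hl h2.1.symm
    · have h3 : φ s(x, p) = φ s(x, r i) := by rw [← hwc, ← h1, ← h2]
      obtain rfl := hcancel _ _ _ hpx (hxr i hi).symm h3
      rw [h1, Sym2.eq_iff] at h2
      rcases h2 with h2 | h2
      · exact hyx i hi h2.1.symm
      · exact (hy i hi).1.1.ne h2.1.symm
    · have h3 : φ s(x, s (σ l)) = φ s(y i, w i) := by
        rw [← h1, h2]
        exact (hnbc _ _).symm
      exact hsw _ (hσk l hl) i hi h3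
  refine ⟨fun i => if i < k then G i else H, fun i => if i < k then r i else x, ?_, ?_, ?_, ?_, ?_,
    ?_⟩
  · intro i _
    by_cases hi : i < k
    · simpa [hi] using (hG i hi).1
    · simpa [hi] using hHtree
  · intro i _
    by_cases hi : i < k
    · simpa only [hi, if_true] using (hG i hi).2.1
    · simpa only [hi, if_false] using hHrb
  · intro i _ j _ hij e
    by_cases hi : i < k <;> by_cases hj : j < k <;> simp only [hi, hj, if_true, if_false]
    · exact hGG i hi j hj hij e
    · exact hGH i hi e
    · exact fun he hf => hGH j hj e hf he
    · omega
  · intro i _ j _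
    by_cases hi : i < k <;> by_cases hj : j < k <;> simp only [hi, hj, if_true, if_false]
    · exact h.root_inj i hi j hj
    · exact fun he => absurd he.symm (hxr i hi)
    · exact fun he => absurd he (hxr j hj)
    · omega
  · intro i hik
    by_cases hi : i < k <;> simp only [hi, if_true, if_false]
    · have h1 := (hG i hi).2.2.2.1
      have h2 := h.degree i hi
      rw [degreeDefect_succ hi]
      omega
    · obtain rfl : i = k := by omega
      have : degreeDefect i (i + 1) = i + 1 := by
        unfold degreeDefect
        split <;> omega
      omega
  · intro i hik
    by_cases hi : i < k <;> simp only [hi, if_true, if_false]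
    · have h1 := (hG i hi).2.2.2.2
      have h2 := h.leaves i hi
      rw [degreeDefect_succ hi]
      omega
    · obtain rfl : i = k := by omega
      have : degreeDefect i (i + 1) = i + 1 := by
        unfold degreeDefect
        split <;> omega
      omega

/-- A single star is a packing. -/
theorem isPacking_star {φ : Sym2 (Fin n) → Fin c} (hφ : ProperEdgeColoring φ) (x : Fin n) :
    IsPacking φ 1 (fun _ => SimpleGraph.fromRel fun a _ => a = x) fun _ => x := by
  set G : SimpleGraph (Fin n) := SimpleGraph.fromRel fun a _ => a = x with hG
  have hadj : ∀ a b, G.Adj a b ↔ a ≠ b ∧ (a = x ∨ b = x) := by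
    intro a b
    simp [hG]
  have hedge : ∀ e ∈ G.edgeSet, ∃ p, p ≠ x ∧ e = s(x, p) := by
    rintro ⟨a, b⟩ hab
    obtain ⟨hne, rfl | rfl⟩ := (hadj a b).1 hab
    · exact ⟨b, hne.symm, rfl⟩
    · exact ⟨a, hne, Sym2.eq_swap⟩
  have hn : (univ.erase x).card + 1 = n := by
    simpa using card_erase_add_one (mem_univ x)
  have hnbr : G.neighborSet x = ((univ.erase x : Finset (Fin n)) : Set (Fin n)) := by
    ext p
    simp [hadj, eq_comm]
  have hreach : ∀ a, G.Reachable a x := by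
    intro a
    by_cases hax : a = x
    · rw [hax]
    · exact SimpleGraph.Adj.reachable ((hadj a x).2 ⟨hax, Or.inr rfl⟩)
  have hconn : G.Connected :=
    { preconnected := fun a b => (hreach a).trans (hreach b).symm
      nonempty := ⟨x⟩ }
  constructor
  · intro _ _
    refine isTree_of_connected_of_ncard_le hconn ?_
    have h1 : G.edgeSet ⊆ ((univ.erase x).image fun p => s(x, p) : Finset (Sym2 (Fin n))) := by
      intro e he
      obtain ⟨p, hp, rfl⟩ := hedge e he
      exact mem_coe.mpr (mem_image_of_mem _ (by simpa using hp))
    have h2 := Set.ncard_le_ncard h1 (Set.toFinite _)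
    rw [Set.ncard_coe_finset] at h2
    have h3 : ((univ.erase x).image fun p => s(x, p)).card ≤ _ := card_image_le
    omega
  · intro _ _ e he f hf hef
    obtain ⟨p, hp, rfl⟩ := hedge e he
    obtain ⟨q, hq, rfl⟩ := hedge f hf
    by_contra hne
    exact hφ x p q hp.symm hq.symm (fun hpq => hne (by rw [hpq])) hef
  · omega
  · omega
  · intro i hi
    obtain rfl : i = 0 := by omega
    rw [hnbr, Set.ncard_coe_finset]
    simpa [degreeDefect] using hn
  · intro i hi
    obtain rfl : i = 0 := by omega
    have hsub : ((univ.erase x : Finset (Fin n)) : Set (Fin n)) ⊆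
        {p | G.Adj x p ∧ (G.neighborSet p).ncard = 1} := by
      intro p hp
      have hpx : p ≠ x := by simpa using hp
      refine isLeafAt_of_forall ((hadj x p).2 ⟨hpx.symm, Or.inl rfl⟩) fun q hq => ?_
      rcases ((hadj p q).1 hq).2 with h | h
      · exact absurd h hpx
      · exact h
    have h1 := Set.ncard_le_ncard hsub (Set.toFinite _)
    rw [Set.ncard_coe_finset] at h1
    simp only [leavesAdj, degreeDefect]
    omega

theorem exists_isPacking {m : ℕ} (hm : 1 ≤ m) {φ : Sym2 (Fin (2 * m)) → Fin (2 * m - 1)}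
    (hφ : ProperEdgeColoring φ) {k : ℕ} (hk : 1 ≤ k) (hkm : 3 * k ^ 2 ≤ 2 * m + 3) :
    ∃ T r, IsPacking φ k T r := by
  induction k, hk using Nat.le_induction with
  | base => exact ⟨_, _, isPacking_star hφ ⟨0, by omega⟩⟩
  | succ k hk ih =>
    obtain ⟨T, r, h⟩ := ih (by nlinarith)
    refine h.exists_succ hφ hk (by nlinarith) ?_
    rcases hk.eq_or_lt with rfl | hk
    · omega
    · obtain ⟨l, rfl⟩ : ∃ l, k = l + 2 := ⟨k - 2, by omega⟩
      have : 8 * (l + 2) + 4 * (l + 2 - 1) + 1 = 12 * l + 21 := by omega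
      nlinarith

end RainbowTrees

/-- If `m ≥ 1`, `φ` is a proper `(2m-1)`-edge-coloring of `K_{2m}`,
and `1 ≤ k ≤ ⌊√(6m+9)/3⌋`, then there exist `k` pairwise edge-disjoint rainbow
spanning trees of `K_{2m}`, with designated roots, satisfying condition `f(k)`. -/
theorem statement1 (m k : ℕ) (hm : 1 ≤ m) (hk : 1 ≤ k)
    (hkΩ : k ≤ ⌊Real.sqrt (6 * (m : ℝ) + 9) / 3⌋₊)
    (φ : Sym2 (Fin (2 * m)) → Fin (2 * m - 1))
    (hφ : ProperEdgeColoring φ) :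
    ∃ (T : Fin k → SimpleGraph (Fin (2 * m))) (r : Fin k → Fin (2 * m)),
      (∀ i, (T i).IsTree) ∧
      (∀ i, Set.InjOn φ (T i).edgeSet) ∧
      (∀ i j, i ≠ j → Disjoint (T i).edgeSet (T j).edgeSet) ∧
      CondF m k T r := by
  obtain ⟨T, r, h⟩ := RainbowTrees.exists_isPacking hm hφ hk (by
    have h1 := (Nat.le_floor_iff (by positivity)).mp hkΩ
    have h2 : (3 * (k : ℝ)) ^ 2 ≤ 6 * m + 9 := by
      rw [← Real.le_sqrt (by positivity) (by positivity)]
      linarith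
    have h3 : 3 * (k : ℝ) ^ 2 ≤ 2 * m + 3 := by nlinarith
    exact_mod_cast h3)
  refine ⟨fun i => T i, fun i => r i, fun i => h.isTree i i.2, fun i => h.rainbow i i.2,
    fun i j hij => Set.disjoint_left.mpr
      (h.disjoint i i.2 j j.2 fun hij' => hij (Fin.ext hij')), ?_, ?_, ?_⟩
  · exact fun i j hij => Fin.ext (h.root_inj i i.2 j j.2 hij)
  · intro i hi
    have h1 := h.degree i i.2
    have h2 := h.leaves i i.2
    simp only [RainbowTrees.degreeDefect, hi, if_true] at h1 h2
    simp only [hi]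
    omega
  · intro i hi
    have h1 := h.degree i i.2
    have h2 := h.leaves i i.2
    have h3 := i.2
    simp only [RainbowTrees.degreeDefect, show (i : ℕ) ≠ 0 by omega, if_false] at h1 h2
    dsimp only
    omega
end

section
/- Let m ≥ 1 be an integer, let φ be a proper (2m−1)-edge-coloring of K_{2m}, and let k be an integer with 2 ≤ k ≤ ⌊√(6m+9)/3⌋. Suppose K_{2m} contains k−1 pairwise edge-disjoint rainbow spanning trees T_1, …, T_{k−1} with designated roots r_1, …, r_{k−1} satisfying condition f(k−1). Then K_{2m} contains k pairwise edge-disjoint rainbow spanning trees with designated roots satisfying condition f(k). -/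
open Finset

/-- If every prefix admits an admissible next element, admissible sequences exist. -/
theorem exists_seq_of_forall_prefix {α : Type*} [Inhabited α] (Q : ℕ → (ℕ → α) → α → Prop)
    (hQ : ∀ t f g a, (∀ j < t, f j = g j) → Q t f a → Q t g a) (N : ℕ)
    (h : ∀ t < N, ∀ f, (∀ s < t, Q s f (f s)) → ∃ a, Q t f a) :
    ∃ f : ℕ → α, ∀ t < N, Q t f (f t) := by
  induction N with
  | zero => exact ⟨fun _ => default, fun t ht => absurd ht (Nat.not_lt_zero t)⟩
  | succ N ih =>
    obtain ⟨f, hf⟩ := ih fun t ht => h t (ht.trans N.lt_succ_self)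
    obtain ⟨a, ha⟩ := h N N.lt_succ_self f hf
    refine ⟨Function.update f N a, fun t ht => ?_⟩
    rcases (Nat.lt_succ_iff_lt_or_eq.mp ht) with ht | rfl
    · rw [Function.update_of_ne ht.ne]
      refine hQ t f _ _ (fun j hj => ?_) (hf t ht)
      rw [Function.update_of_ne (hj.trans ht).ne]
    · rw [Function.update_self]
      refine hQ t f _ _ (fun j hj => ?_) ha
      rw [Function.update_of_ne hj.ne]

/-- In a proper `(n-1)`-edge-coloring of `K_n`, every color appears exactly once at each vertex. -/
theorem ProperEdgeColoring.exists_partner {n : ℕ} {φ : Sym2 (Fin n) → Fin (n - 1)}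
    (hφ : ProperEdgeColoring φ) :
    ∃ p : Fin n → Fin (n - 1) → Fin n, ∀ a c b, p a c = b ↔ b ≠ a ∧ φ s(a, b) = c := by
  classical
  have key : ∀ a c, ∃ b, b ≠ a ∧ φ s(a, b) = c := by
    intro a c
    have hinj : Set.InjOn (fun b => φ s(a, b)) (univ.erase a : Finset (Fin n)) := by
      intro b hb b' hb' h
      by_contra hne
      exact hφ a b b' (by simpa using (Finset.ne_of_mem_erase hb).symm)
        (by simpa using (Finset.ne_of_mem_erase hb').symm) hne h
    have hcard : ((univ.erase a).image (fun b => φ s(a, b))).card = n - 1 := by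
      rw [Finset.card_image_of_injOn hinj]; simp
    have huniv : (univ.erase a).image (fun b => φ s(a, b)) = univ :=
      (Finset.card_eq_iff_eq_univ _).mp (by simpa using hcard)
    have hc : c ∈ (univ.erase a).image (fun b => φ s(a, b)) := huniv ▸ mem_univ c
    obtain ⟨b, hb, rfl⟩ := Finset.mem_image.mp hc
    exact ⟨b, Finset.ne_of_mem_erase hb, rfl⟩
  choose p hp using key
  refine ⟨p, fun a c b => ⟨?_, fun ⟨hb, h⟩ => ?_⟩⟩
  · rintro rfl; exact hp a c
  · by_contra hne
    exact hφ a (p a c) b (hp a c).1.symm hb.symm hne ((hp a c).2.trans h.symm)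

/-- A connected graph on `n` vertices that is rainbow with respect to `n - 1` colors is a tree. -/
theorem SimpleGraph.Connected.isTree_of_injOn {n : ℕ} {φ : Sym2 (Fin n) → Fin (n - 1)}
    {G : SimpleGraph (Fin n)} (hG : G.Connected) (h : Set.InjOn φ G.edgeSet) : G.IsTree := by
  classical
  rw [SimpleGraph.isTree_iff_connected_and_card]
  refine ⟨hG, ?_⟩
  have h1 := hG.card_vert_le_card_edgeSet_add_one
  have h2 : Nat.card G.edgeSet ≤ n - 1 := by
    have := Nat.card_le_card_of_injective _ h.injective
    simpa using this
  have h3 : 0 < n := Fin.pos (hG.nonempty.some)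
  simp only [Nat.card_eq_fintype_card, Fintype.card_fin] at *
  omega

theorem SimpleGraph.Adj.eq_of_ncard_neighborSet {V : Type*} {G : SimpleGraph V} {v a b : V}
    (ha : G.Adj v a) (h : (G.neighborSet v).ncard = 1) (hb : G.Adj v b) : b = a := by
  obtain ⟨w, hw⟩ := Set.ncard_eq_one.mp h
  have h1 : a ∈ G.neighborSet v := ha
  have h2 : b ∈ G.neighborSet v := hb
  rw [hw] at h1 h2
  exact h2.trans h1.symm

/-- In a rainbow graph, the degrees of two distinct vertices add up to at most `n`. -/
theorem ncard_neighborSet_add_le {n : ℕ} {φ : Sym2 (Fin n) → Fin (n - 1)}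
    {G : SimpleGraph (Fin n)} (h : Set.InjOn φ G.edgeSet) {a b : Fin n} (hab : a ≠ b) :
    (G.neighborSet a).ncard + (G.neighborSet b).ncard ≤ n := by
  classical
  have key : ∀ v, (G.incidenceSet v).ncard = (G.neighborSet v).ncard := fun v =>
    Nat.card_congr (G.incidenceSetEquivNeighborSet v)
  have h1 := Set.ncard_union_add_ncard_inter (G.incidenceSet a) (G.incidenceSet b)
  have h2 : (G.incidenceSet a ∩ G.incidenceSet b).ncard ≤ 1 := by
    rw [← Set.ncard_singleton s(a, b)]
    exact Set.ncard_le_ncard (G.incidenceSet_inter_incidenceSet_subset hab)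
  have h3 : (G.incidenceSet a ∪ G.incidenceSet b).ncard ≤ n - 1 := by
    have hs : G.incidenceSet a ∪ G.incidenceSet b ⊆ G.edgeSet :=
      Set.union_subset (G.incidenceSet_subset a) (G.incidenceSet_subset b)
    rw [← (h.mono hs).ncard_image]
    exact (Set.ncard_le_ncard (Set.subset_univ _)).trans (by simp [Set.ncard_univ])
  have h4 : 0 < n := Fin.pos a
  rw [key, key] at h1
  omega

/-- The graph obtained from `G` by replacing the edges `rq` and `rv` by `qx` and `vy`. -/
def swapEdges {V : Type*} (G : SimpleGraph V) (r q v x y : V) : SimpleGraph V :=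
  SimpleGraph.fromEdgeSet ((G.edgeSet \ {s(r, q), s(r, v)}) ∪ {s(q, x), s(v, y)})

theorem mem_edgeSet_swapEdges {V : Type*} {G : SimpleGraph V} {r q v x y : V} (hx : x ≠ q)
    (hy : y ≠ v) (e : Sym2 V) : e ∈ (swapEdges G r q v x y).edgeSet ↔
      (e ∈ G.edgeSet ∧ e ≠ s(r, q) ∧ e ≠ s(r, v)) ∨ e = s(q, x) ∨ e = s(v, y) := by
  rw [swapEdges, SimpleGraph.edgeSet_fromEdgeSet]
  constructor
  · rintro ⟨h, -⟩
    simpa [or_comm, or_left_comm, or_assoc] using h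
  · intro h
    refine ⟨by simpa [or_comm, or_left_comm, or_assoc] using h, ?_⟩
    rcases h with h | rfl | rfl
    · exact G.not_isDiag_of_mem_edgeSet h.1
    · simpa using hx.symm
    · simpa using hy.symm

theorem swapEdges_connected {V : Type*} {G : SimpleGraph V} {r q v x y : V} (hG : G.Connected)
    (hq : G.Adj r q) (hq1 : (G.neighborSet q).ncard = 1)
    (hv : G.Adj r v) (hv1 : (G.neighborSet v).ncard = 1)
    (hxq : x ≠ q) (hxv : x ≠ v) (hyq : y ≠ q) (hyv : y ≠ v) :
    (swapEdges G r q v x y).Connected := by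
  classical
  set H := swapEdges G r q v x y with hH
  have hmem := mem_edgeSet_swapEdges (G := G) (r := r) hxq hyv
  rw [← hH] at hmem
  let f : V → V := fun a => if a = q ∨ a = v then r else a
  have hrq : r ≠ q := hq.ne
  have hrv : r ≠ v := hv.ne
  have hadj : ∀ a b, G.Adj a b → H.Reachable (f a) (f b) := by
    intro a b hab
    by_cases ha : a = q ∨ a = v
    · have hb : b = r := by
        rcases ha with rfl | rfl
        · exact hq.symm.eq_of_ncard_neighborSet hq1 hab
        · exact hv.symm.eq_of_ncard_neighborSet hv1 hab
      subst hb
      simp [f, ha]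
    by_cases hb : b = q ∨ b = v
    · have ha' : a = r := by
        rcases hb with rfl | rfl
        · exact hq.symm.eq_of_ncard_neighborSet hq1 hab.symm
        · exact hv.symm.eq_of_ncard_neighborSet hv1 hab.symm
      subst ha'
      simp [f, hb]
    · simp only [f, ha, hb, if_false]
      refine SimpleGraph.Adj.reachable ?_
      rw [← SimpleGraph.mem_edgeSet, hmem]
      refine Or.inl ⟨hab, ?_, ?_⟩ <;>
      · rw [Ne, Sym2.eq_iff]; tauto
  have hreach : ∀ a b, G.Reachable a b → H.Reachable (f a) (f b) := by
    rintro a b ⟨w⟩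
    induction w with
    | nil => rfl
    | cons h _ ih => exact (hadj _ _ h).trans ih
  have hr : ∀ a, a ≠ q → a ≠ v → H.Reachable a r := by
    intro a ha hav
    have := hreach a r (hG.preconnected a r)
    simpa [f, ha, hav, hrq, hrv] using this
  have hall : ∀ a, H.Reachable a r := by
    intro a
    by_cases ha : a = q
    · subst ha
      have : H.Adj a x := by rw [← SimpleGraph.mem_edgeSet, hmem]; simp
      exact this.reachable.trans (hr x hxq hxv)
    by_cases hav : a = v
    · subst hav
      have : H.Adj a y := by rw [← SimpleGraph.mem_edgeSet, hmem]; simp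
      exact this.reachable.trans (hr y hyq hyv)
    exact hr a ha hav
  have : Nonempty V := ⟨r⟩
  exact ⟨fun a b => (hall a).trans (hall b).symm⟩

theorem swapEdges_injOn {V C : Type*} {φ : Sym2 V → C} {G : SimpleGraph V} {r q v x y : V}
    (h : Set.InjOn φ G.edgeSet) (hq : G.Adj r q) (hv : G.Adj r v) (hvq : v ≠ q)
    (hx : x ≠ q) (hy : y ≠ v)
    (hφx : φ s(q, x) = φ s(r, v)) (hφy : φ s(v, y) = φ s(r, q)) :
    Set.InjOn φ (swapEdges G r q v x y).edgeSet := by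
  have hqm : s(r, q) ∈ G.edgeSet := hq
  have hvm : s(r, v) ∈ G.edgeSet := hv
  have hne : φ s(r, q) ≠ φ s(r, v) := fun he => by
    have := h hqm hvm he
    rw [Sym2.congr_right] at this
    exact hvq this.symm
  intro e he e' he' hee
  rw [mem_edgeSet_swapEdges hx hy] at he he'
  rcases he with ⟨h1, h2, h3⟩ | rfl | rfl <;> rcases he' with ⟨h1', h2', h3'⟩ | rfl | rfl
  · exact h h1 h1' hee
  · exact absurd (h h1 hvm (hee.trans hφx)) h3
  · exact absurd (h h1 hqm (hee.trans hφy)) h2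
  · exact absurd (h h1' hvm (hee.symm.trans hφx)) h3'
  · rfl
  · exact absurd (hφy.symm.trans (hee.symm.trans hφx)) hne
  · exact absurd (h h1' hqm (hee.symm.trans hφy)) h2'
  · exact absurd (hφy.symm.trans (hee.trans hφx)) hne
  · rfl

theorem swapEdges_ncard_neighborSet {V : Type*} [Finite V] {G : SimpleGraph V} {r q v x y : V}
    (hq : G.Adj r q) (hv : G.Adj r v) (hvq : v ≠ q)
    (hxq : x ≠ q) (hyv : y ≠ v) (hxr : x ≠ r) (hyr : y ≠ r) :
    ((swapEdges G r q v x y).neighborSet r).ncard + 2 = (G.neighborSet r).ncard := by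
  have hrq : r ≠ q := hq.ne
  have hrv : r ≠ v := hv.ne
  have heq : (swapEdges G r q v x y).neighborSet r = G.neighborSet r \ {q, v} := by
    ext w
    rw [SimpleGraph.mem_neighborSet, ← SimpleGraph.mem_edgeSet, mem_edgeSet_swapEdges hxq hyv]
    simp only [SimpleGraph.mem_edgeSet, Set.mem_sdiff, SimpleGraph.mem_neighborSet,
      Set.mem_insert_iff, Set.mem_singleton_iff, Ne, Sym2.eq_iff]
    grind
  have hsub : ({q, v} : Set V) ⊆ G.neighborSet r := by
    rintro w (rfl | rfl)
    · exact hq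
    · exact hv
  rw [heq, ← Set.ncard_pair hvq.symm]
  exact Set.ncard_sdiff_add_ncard_of_subset hsub

theorem swapEdges_leavesAdj {V : Type*} [Finite V] {G : SimpleGraph V} {r q v x y : V}
    (hxq : x ≠ q) (hyv : y ≠ v) :
    leavesAdj G r ≤ leavesAdj (swapEdges G r q v x y) r + 4 := by
  set L : Set V := {w | G.Adj r w ∧ (G.neighborSet w).ncard = 1} with hL
  have hsub : L \ {q, v, x, y} ⊆ {w | (swapEdges G r q v x y).Adj r w ∧
      ((swapEdges G r q v x y).neighborSet w).ncard = 1} := by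
    rintro w ⟨⟨h1, h2⟩, h3⟩
    simp only [Set.mem_insert_iff, Set.mem_singleton_iff, not_or] at h3
    obtain ⟨hwq, hwv, hwx, hwy⟩ := h3
    have hadj : ∀ u, (swapEdges G r q v x y).Adj w u ↔ u = r := by
      intro u
      rw [← SimpleGraph.mem_edgeSet, mem_edgeSet_swapEdges hxq hyv]
      constructor
      · rintro (⟨h, -, -⟩ | h | h)
        · exact h1.symm.eq_of_ncard_neighborSet h2 h
        · rw [Sym2.eq_iff] at h; tauto
        · rw [Sym2.eq_iff] at h; tauto
      · rintro rfl
        refine Or.inl ⟨h1.symm, ?_, ?_⟩ <;>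
        · rw [Ne, Sym2.eq_iff]
          have := h1.ne
          grind
    refine ⟨((hadj r).mpr rfl).symm, ?_⟩
    rw [Set.ncard_eq_one]
    exact ⟨r, Set.ext hadj⟩
  have h1 := Set.ncard_le_ncard hsub
  have h2 := Set.ncard_le_ncard_sdiff_add_ncard L {q, v, x, y}
  have h3 : ({q, v, x, y} : Set V).ncard ≤ 4 := by
    refine (Set.ncard_insert_le _ _).trans (Nat.succ_le_succ ?_)
    refine (Set.ncard_insert_le _ _).trans (Nat.succ_le_succ ?_)
    refine (Set.ncard_insert_le _ _).trans (Nat.succ_le_succ ?_)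
    simp
  unfold leavesAdj
  rw [← hL]
  omega

/-- The star at `q`, with each vertex `x i` attached to `z i` instead of `q`. -/
def modifiedStar {V ι : Type*} (q : V) (x z : ι → V) : SimpleGraph V :=
  SimpleGraph.fromEdgeSet ({e | ∃ w, (∀ i, w ≠ x i) ∧ e = s(q, w)} ∪
    Set.range fun i => s(x i, z i))

section ModifiedStar

variable {V ι : Type*} {q : V} {x z : ι → V}

theorem mem_edgeSet_modifiedStar (hzx : ∀ i j, z i ≠ x j) (e : Sym2 V) :
    e ∈ (modifiedStar q x z).edgeSet ↔
      (∃ w, w ≠ q ∧ (∀ i, w ≠ x i) ∧ e = s(q, w)) ∨ ∃ i, e = s(x i, z i) := by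
  rw [modifiedStar, SimpleGraph.edgeSet_fromEdgeSet]
  constructor
  · rintro ⟨⟨w, hw, rfl⟩ | ⟨i, rfl⟩, h⟩
    · exact Or.inl ⟨w, fun hwq => h (by simp [hwq]), hw, rfl⟩
    · exact Or.inr ⟨i, rfl⟩
  · rintro (⟨w, hwq, hw, rfl⟩ | ⟨i, rfl⟩)
    · exact ⟨Or.inl ⟨w, hw, rfl⟩, by simpa using hwq.symm⟩
    · exact ⟨Or.inr ⟨i, rfl⟩, by simpa using (hzx i i).symm⟩

theorem modifiedStar_connected (hzx : ∀ i j, z i ≠ x j) :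
    (modifiedStar q x z).Connected := by
  have hmem := mem_edgeSet_modifiedStar (q := q) hzx
  have h1 : ∀ w, (∀ i, w ≠ x i) → (modifiedStar q x z).Reachable w q := by
    intro w hw
    by_cases hwq : w = q
    · rw [hwq]
    · refine SimpleGraph.Adj.reachable (SimpleGraph.Adj.symm ?_)
      rw [← SimpleGraph.mem_edgeSet, hmem]
      exact Or.inl ⟨w, hwq, hw, rfl⟩
  have h2 : ∀ w, (modifiedStar q x z).Reachable w q := by
    intro w
    by_cases hw : ∃ i, w = x i
    · obtain ⟨i, rfl⟩ := hw
      have : (modifiedStar q x z).Adj (x i) (z i) := by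
        rw [← SimpleGraph.mem_edgeSet, hmem]
        exact Or.inr ⟨i, rfl⟩
      exact this.reachable.trans (h1 _ (hzx i))
    · push Not at hw
      exact h1 w hw
  have : Nonempty V := ⟨q⟩
  exact ⟨fun a b => (h2 a).trans (h2 b).symm⟩

theorem modifiedStar_injOn {C : Type*} {φ : Sym2 V → C} {σ : ι → ι} (hσ : σ.Injective)
    (hzx : ∀ i j, z i ≠ x j) (hx : x.Injective) (hxq : ∀ i, x i ≠ q)
    (hφ : ∀ a b, a ≠ q → b ≠ q → φ s(q, a) = φ s(q, b) → a = b)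
    (hz : ∀ i, φ s(x i, z i) = φ s(q, x (σ i))) :
    Set.InjOn φ (modifiedStar q x z).edgeSet := by
  intro e he e' he' hee
  rw [mem_edgeSet_modifiedStar hzx] at he he'
  rcases he with ⟨w, hwq, hw, rfl⟩ | ⟨i, rfl⟩ <;>
    rcases he' with ⟨w', hwq', hw', rfl⟩ | ⟨i', rfl⟩
  · rw [hφ w w' hwq hwq' hee]
  · exact absurd (hφ _ _ hwq (hxq _) (hee.trans (hz i'))) (hw _)
  · exact absurd (hφ _ _ hwq' (hxq _) (hee.symm.trans (hz i))) (hw' _)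
  · rw [hσ (hx (hφ _ _ (hxq _) (hxq _) ((hz i).symm.trans (hee.trans (hz i')))))]

theorem modifiedStar_adj_center (hzx : ∀ i j, z i ≠ x j) (hxq : ∀ i, x i ≠ q)
    (hzq : ∀ i, z i ≠ q) (w : V) :
    (modifiedStar q x z).Adj q w ↔ w ≠ q ∧ ∀ i, w ≠ x i := by
  rw [← SimpleGraph.mem_edgeSet, mem_edgeSet_modifiedStar hzx]
  constructor
  · rintro (⟨u, huq, hu, h⟩ | ⟨i, h⟩)
    · rw [Sym2.congr_right] at h
      exact h ▸ ⟨huq, hu⟩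
    · rw [Sym2.eq_iff] at h
      have := hxq i
      have := hzq i
      tauto
  · rintro ⟨h1, h2⟩
    exact Or.inl ⟨w, h1, h2, rfl⟩

theorem modifiedStar_ncard_neighborSet [Fintype V] [Fintype ι] (hzx : ∀ i j, z i ≠ x j)
    (hx : x.Injective) (hxq : ∀ i, x i ≠ q) (hzq : ∀ i, z i ≠ q) :
    ((modifiedStar q x z).neighborSet q).ncard + (Fintype.card ι + 1) = Fintype.card V := by
  have heq : (modifiedStar q x z).neighborSet q = (insert q (Set.range x))ᶜ := by
    ext w
    rw [SimpleGraph.mem_neighborSet, modifiedStar_adj_center hzx hxq hzq]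
    simp [eq_comm]
  have h1 : (insert q (Set.range x)).ncard = Fintype.card ι + 1 := by
    rw [Set.ncard_insert_of_notMem (by simpa using hxq), ← Set.image_univ,
      Set.ncard_image_of_injective _ hx, Set.ncard_univ, Nat.card_eq_fintype_card]
  have h2 := Set.ncard_add_ncard_compl (insert q (Set.range x))
  rw [Nat.card_eq_fintype_card] at h2
  rw [heq]
  omega

theorem modifiedStar_leavesAdj [Fintype V] [Fintype ι] (hzx : ∀ i j, z i ≠ x j)
    (hxq : ∀ i, x i ≠ q) (hzq : ∀ i, z i ≠ q) :
    Fintype.card V ≤ leavesAdj (modifiedStar q x z) q + (2 * Fintype.card ι + 1) := by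
  have hsub : (insert q (Set.range x ∪ Set.range z))ᶜ ⊆ {w | (modifiedStar q x z).Adj q w ∧
      ((modifiedStar q x z).neighborSet w).ncard = 1} := by
    intro w hw
    simp only [Set.mem_compl_iff, Set.mem_insert_iff, Set.mem_union, Set.mem_range, not_or,
      not_exists] at hw
    obtain ⟨hwq, hwx, hwz⟩ := hw
    have hadj : (modifiedStar q x z).Adj q w :=
      (modifiedStar_adj_center hzx hxq hzq w).mpr ⟨hwq, fun i h => hwx i h.symm⟩
    refine ⟨hadj, Set.ncard_eq_one.mpr ⟨q, Set.ext fun u => ⟨fun hu => ?_, ?_⟩⟩⟩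
    · rw [SimpleGraph.mem_neighborSet, ← SimpleGraph.mem_edgeSet,
        mem_edgeSet_modifiedStar hzx] at hu
      rcases hu with ⟨u', -, -, h⟩ | ⟨i, h⟩
      · rw [Sym2.eq_iff] at h
        rcases h with ⟨h, -⟩ | ⟨-, h⟩
        · exact absurd h hwq
        · exact h
      · rw [Sym2.eq_iff] at h
        rcases h with ⟨h, -⟩ | ⟨h, -⟩
        · exact absurd h.symm (hwx i)
        · exact absurd h.symm (hwz i)
    · rintro rfl
      exact hadj.symm
  have h0 : ∀ f : ι → V, (Set.range f).ncard ≤ Fintype.card ι := fun f => by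
    rw [← Set.image_univ]
    refine (Set.ncard_image_le).trans ?_
    rw [Set.ncard_univ, Nat.card_eq_fintype_card]
  have h1 := Set.ncard_insert_le q (Set.range x ∪ Set.range z)
  have h2 := Set.ncard_union_le (Set.range x) (Set.range z)
  have h3 := Set.ncard_le_ncard hsub
  have h4 := Set.ncard_add_ncard_compl (insert q (Set.range x ∪ Set.range z))
  rw [Nat.card_eq_fintype_card] at h4
  have h5 := h0 x
  have h6 := h0 z
  unfold leavesAdj
  omega

end ModifiedStar

/-- The vertices whose edge of color `c` lies in one of `K` rainbow graphs number at most `2K`. -/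
theorem card_endpoints_le {n : ℕ} {φ : Sym2 (Fin n) → Fin (n - 1)}
    {p : Fin n → Fin (n - 1) → Fin n} (hp : ∀ a c b, p a c = b ↔ b ≠ a ∧ φ s(a, b) = c)
    {T : ℕ → SimpleGraph (Fin n)} {K : ℕ} (hT : ∀ l < K, Set.InjOn φ (T l).edgeSet)
    (c : Fin (n - 1)) (S : Finset (Fin n)) (hS : ∀ a ∈ S, ∃ l < K, (T l).Adj a (p a c)) :
    S.card ≤ 2 * K := by
  classical
  have hsub : S ⊆ (range K).biUnion fun l => S.filter fun a => (T l).Adj a (p a c) := by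
    intro a ha
    obtain ⟨l, hl, h⟩ := hS a ha
    exact mem_biUnion.mpr ⟨l, mem_range.mpr hl, mem_filter.mpr ⟨ha, h⟩⟩
  refine (card_le_card hsub).trans ((card_biUnion_le_card_mul _ _ 2 fun l hl => ?_).trans ?_)
  · rcases (S.filter fun a => (T l).Adj a (p a c)).eq_empty_or_nonempty with h | ⟨a, ha⟩
    · simp [h]
    · refine (card_le_card (t := {a, p a c}) fun b hb => ?_).trans card_le_two
      have ha' : s(a, p a c) ∈ (T l).edgeSet := (mem_filter.mp ha).2
      have hb' : s(b, p b c) ∈ (T l).edgeSet := (mem_filter.mp hb).2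
      have := hT l (mem_range.mp hl) hb' ha'
        ((((hp b c _).mp rfl).2).trans (((hp a c _).mp rfl).2).symm)
      rw [Sym2.eq_iff] at this
      simp only [mem_insert, mem_singleton]
      tauto
  · rw [card_range, mul_comm]

theorem card_not_leaf_add {n : ℕ} (G : SimpleGraph (Fin n)) (r : Fin n) (S : Finset (Fin n))
    (hS : ∀ w ∈ S, ¬ (G.Adj r w ∧ (G.neighborSet w).ncard = 1)) :
    S.card + leavesAdj G r ≤ n := by
  classical
  have h1 : leavesAdj G r ≤ (Sᶜ : Finset (Fin n)).card := by
    rw [leavesAdj, ← Set.ncard_coe_finset]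
    refine Set.ncard_le_ncard fun w hw => ?_
    simp only [coe_compl, Set.mem_compl_iff, mem_coe]
    exact fun h => hS w h hw
  have h2 := S.card_add_card_compl
  rw [Fintype.card_fin] at h2
  omega

/-- Some vertex is a leaf adjacent to the root in each of the trees. -/
theorem exists_common_leaf {n K : ℕ} (T : ℕ → SimpleGraph (Fin n)) (r : ℕ → Fin n)
    (hn : 3 * K ^ 2 < n)
    (hleaf : ∀ l < K, n + 2 * l + 1 ≤ leavesAdj (T l) (r l) + 4 * K) :
    ∃ q, ∀ l < K, (T l).Adj (r l) q ∧ ((T l).neighborSet q).ncard = 1 := by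
  classical
  by_contra! hcon
  let B : ℕ → Finset (Fin n) := fun l =>
    univ.filter fun w => ¬ ((T l).Adj (r l) w ∧ ((T l).neighborSet w).ncard = 1)
  have hcov : (univ : Finset (Fin n)) ⊆ (range K).biUnion B := by
    intro w _
    obtain ⟨l, hl, h⟩ := hcon w
    simp only [mem_biUnion, mem_range, B, mem_filter, mem_univ, true_and, not_and]
    exact ⟨l, hl, h⟩
  have hB : ∀ l < K, (B l).card + (2 * l + 1) ≤ 4 * K := by
    intro l hl
    have h1 := card_not_leaf_add (T l) (r l) (B l) (fun w hw => (mem_filter.mp hw).2)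
    have h2 := hleaf l hl
    omega
  have h1 := (card_le_card hcov).trans card_biUnion_le
  have h2 : ∑ l ∈ range K, ((B l).card + (2 * l + 1)) ≤ ∑ l ∈ range K, 4 * K :=
    sum_le_sum fun l hl => hB l (mem_range.mp hl)
  have h3 : ∀ N : ℕ, ∑ l ∈ range N, (2 * l + 1) = N ^ 2 := by
    intro N
    induction N with
    | zero => simp
    | succ N ih => rw [sum_range_succ, ih]; ring
  rw [sum_add_distrib, h3, sum_const, card_range, smul_eq_mul] at h2
  rw [card_univ, Fintype.card_fin] at h1
  nlinarith

/-- The vertex `a` can follow `f 0, …, f (t - 1)` in a sequence of vertices to be detached from the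
star at `q`: its successor in the sequence is to be joined along the color of `q a`, and for
`t < K` the edge `q a` replaces an edge of the same color at the root of `T t`. -/
structure IsAdmissible {n : ℕ} (φ : Sym2 (Fin n) → Fin (n - 1)) (p : Fin n → Fin (n - 1) → Fin n)
    (T : ℕ → SimpleGraph (Fin n)) (r : ℕ → Fin n) (q : Fin n) (K t : ℕ) (f : ℕ → Fin n)
    (a : Fin n) : Prop where
  ne_center : a ≠ q
  ne_root : ∀ l < K, a ≠ r l
  ne_prev : ∀ j < t, a ≠ f j
  ne_prev_partner : ∀ j, j + 1 < t → a ≠ p (f (j + 1)) (φ s(q, f j))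
  partner_ne : ∀ s, t = s + 1 → ∀ j < t, p a (φ s(q, f s)) ≠ f j
  partner_not_adj : ∀ s, t = s + 1 → ∀ l < K, ¬ (T l).Adj a (p a (φ s(q, f s)))
  leaf : t < K → (T t).Adj (r t) (p (r t) (φ s(q, a))) ∧
    ((T t).neighborSet (p (r t) (φ s(q, a)))).ncard = 1
  leaf_not_adj : t < K → ∀ l < K, ¬ (T l).Adj (p (r t) (φ s(q, a)))
    (p (p (r t) (φ s(q, a))) (φ s(r t, q)))
  last_ne : t = K → ∀ j < K, p (f 0) (φ s(q, a)) ≠ f j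
  last_not_adj : t = K → ∀ l < K, ¬ (T l).Adj (f 0) (p (f 0) (φ s(q, a)))

section Admissible

variable {n K : ℕ} {φ : Sym2 (Fin n) → Fin (n - 1)} {p : Fin n → Fin (n - 1) → Fin n}
  {T : ℕ → SimpleGraph (Fin n)} {r : ℕ → Fin n} {q : Fin n}

theorem IsAdmissible.congr (hK : 1 ≤ K) {t : ℕ} {f g : ℕ → Fin n} {a : Fin n}
    (hfg : ∀ j < t, f j = g j) (h : IsAdmissible φ p T r q K t f a) :
    IsAdmissible φ p T r q K t g a where
  ne_center := h.ne_center
  ne_root := h.ne_root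
  ne_prev j hj := hfg j hj ▸ h.ne_prev j hj
  ne_prev_partner j hj := hfg (j + 1) hj ▸ hfg j (by omega) ▸ h.ne_prev_partner j hj
  partner_ne s hs j hj := hfg s (by omega) ▸ hfg j hj ▸ h.partner_ne s hs j hj
  partner_not_adj s hs l hl := hfg s (by omega) ▸ h.partner_not_adj s hs l hl
  leaf := h.leaf
  leaf_not_adj := h.leaf_not_adj
  last_ne ht j hj := hfg 0 (by omega) ▸ hfg j (by omega) ▸ h.last_ne ht j hj
  last_not_adj ht l hl := hfg 0 (by omega) ▸ h.last_not_adj ht l hl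

/-- The general vertices to avoid when extending an admissible sequence. -/
theorem exists_common_forbidden (hp : ∀ a c b, p a c = b ↔ b ≠ a ∧ φ s(a, b) = c)
    (hT : ∀ l < K, Set.InjOn φ (T l).edgeSet) (t : ℕ) (f : ℕ → Fin n) :
    ∃ S : Finset (Fin n), S.card ≤ 3 * K + 1 + 3 * t ∧ ∀ a ∉ S, a ≠ q ∧ (∀ l < K, a ≠ r l) ∧
      (∀ j < t, a ≠ f j) ∧ (∀ j, j + 1 < t → a ≠ p (f (j + 1)) (φ s(q, f j))) ∧
      (∀ s, t = s + 1 → ∀ j < t, p a (φ s(q, f s)) ≠ f j) ∧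
      (∀ s, t = s + 1 → ∀ l < K, ¬ (T l).Adj a (p a (φ s(q, f s)))) := by
  classical
  let E : Finset (Fin n) := univ.filter fun a =>
    ∃ l < K, (T l).Adj a (p a (φ s(q, f (t - 1))))
  have hE : E.card ≤ 2 * K := card_endpoints_le hp hT _ E fun a ha => (mem_filter.mp ha).2
  let A₁ := (range K).image r
  let A₂ := (range t).image f
  let A₃ := (range t).image fun j => p (f (j + 1)) (φ s(q, f j))
  let A₄ := (range t).image fun j => p (f j) (φ s(q, f (t - 1)))
  have h₁ : A₁.card ≤ K := card_image_le.trans (card_range K).le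
  have h₂ : A₂.card ≤ t := card_image_le.trans (card_range t).le
  have h₃ : A₃.card ≤ t := card_image_le.trans (card_range t).le
  have h₄ : A₄.card ≤ t := card_image_le.trans (card_range t).le
  refine ⟨insert q (A₁ ∪ (A₂ ∪ (A₃ ∪ (A₄ ∪ E)))), ?_, fun a ha => ?_⟩
  · have k₁ := card_insert_le q (A₁ ∪ (A₂ ∪ (A₃ ∪ (A₄ ∪ E))))
    have k₂ := card_union_le A₁ (A₂ ∪ (A₃ ∪ (A₄ ∪ E)))
    have k₃ := card_union_le A₂ (A₃ ∪ (A₄ ∪ E))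
    have k₄ := card_union_le A₃ (A₄ ∪ E)
    have k₅ := card_union_le A₄ E
    omega
  · simp only [mem_insert, mem_union, not_or] at ha
    obtain ⟨ha, ha₁, ha₂, ha₃, ha₄, haE⟩ := ha
    refine ⟨ha, fun l hl h => ha₁ ?_, fun j hj h => ha₂ ?_, fun j hj h => ha₃ ?_, ?_, ?_⟩
    · exact mem_image.mpr ⟨l, mem_range.mpr hl, h.symm⟩
    · exact mem_image.mpr ⟨j, mem_range.mpr hj, h.symm⟩
    · exact mem_image.mpr ⟨j, mem_range.mpr (by omega), h.symm⟩
    · rintro s rfl j hj h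
      refine ha₄ (mem_image.mpr ⟨j, mem_range.mpr hj, ?_⟩)
      rw [hp] at h ⊢
      exact ⟨h.1.symm, by rw [Sym2.eq_swap, h.2, Nat.add_sub_cancel]⟩
    · rintro s rfl l hl h
      exact haE (mem_filter.mpr ⟨mem_univ _, l, hl, h⟩)

theorem exists_admissible (hp : ∀ a c b, p a c = b ↔ b ≠ a ∧ φ s(a, b) = c)
    (hT : ∀ l < K, Set.InjOn φ (T l).edgeSet) (hK : 1 ≤ K) (hn : 3 * K ^ 2 + 6 * K ≤ n)
    (hn' : n ≠ 9) (hq : ∀ l < K, (T l).Adj (r l) q)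
    (hleaf : ∀ l < K, n + 3 ≤ leavesAdj (T l) (r l) + 4 * K)
    (hdeg : ∀ l < K, n + 1 ≤ ((T l).neighborSet (r l)).ncard + 2 * K) (t : ℕ) (ht : t ≤ K)
    (f : ℕ → Fin n) (hf : ∀ s < t, IsAdmissible φ p T r q K s f (f s)) :
    ∃ a, IsAdmissible φ p T r q K t f a := by
  classical
  obtain ⟨S, hScard, hS⟩ := exists_common_forbidden (r := r) (q := q) hp hT t f
  suffices h : ∃ R : Finset (Fin n), S.card + R.card < n ∧ ∀ a ∉ S, a ∉ R →
      (t < K → ((T t).Adj (r t) (p (r t) (φ s(q, a))) ∧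
        ((T t).neighborSet (p (r t) (φ s(q, a)))).ncard = 1) ∧
        ∀ l < K, ¬ (T l).Adj (p (r t) (φ s(q, a))) (p (p (r t) (φ s(q, a))) (φ s(r t, q)))) ∧
      (t = K → (∀ j < K, p (f 0) (φ s(q, a)) ≠ f j) ∧
        ∀ l < K, ¬ (T l).Adj (f 0) (p (f 0) (φ s(q, a)))) by
    obtain ⟨R, hR, hR'⟩ := h
    have hcard : (S ∪ R).card < (univ : Finset (Fin n)).card := by
      rw [card_univ, Fintype.card_fin]
      exact (card_union_le S R).trans_lt hR
    obtain ⟨a, -, ha⟩ := exists_mem_notMem_of_card_lt_card hcard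
    rw [mem_union, not_or] at ha
    obtain ⟨h₁, h₂, h₃, h₄, h₅, h₆⟩ := hS a ha.1
    obtain ⟨h₇, h₈⟩ := hR' a ha.1 ha.2
    exact ⟨a, h₁, h₂, h₃, h₄, h₅, h₆, fun h => (h₇ h).1, fun h => (h₇ h).2,
      fun h => (h₈ h).1, fun h => (h₈ h).2⟩
  rcases ht.lt_or_eq with ht | rfl
  · let N : Finset (Fin n) := univ.filter fun w =>
      ¬ ((T t).Adj (r t) w ∧ ((T t).neighborSet w).ncard = 1)
    let E : Finset (Fin n) := univ.filter fun a => ∃ l < K, (T l).Adj a (p a (φ s(r t, q)))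
    have hE : E.card ≤ 2 * K := card_endpoints_le hp hT _ E fun a ha => (mem_filter.mp ha).2
    have hN : N.card + leavesAdj (T t) (r t) ≤ n :=
      card_not_leaf_add _ _ N fun w hw => (mem_filter.mp hw).2
    refine ⟨(N ∪ E).image fun v => p q (φ s(r t, v)), ?_, fun a haS haR => ⟨fun _ => ?_,
      fun h => absurd h ht.ne⟩⟩
    · have k₁ : ((N ∪ E).image fun v => p q (φ s(r t, v))).card ≤ _ := card_image_le
      have k₂ := card_union_le N E
      have k₃ := hleaf t ht
      have k₄ : 12 * K < 3 * K ^ 2 + 6 * K + 5 := by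
        zify
        nlinarith [sq_nonneg ((K : ℤ) - 1)]
      omega
    · have haq := (hS a haS).1
      have hnot : p (r t) (φ s(q, a)) ∉ N ∪ E := fun h =>
        haR (mem_image.mpr ⟨_, h, (hp _ _ _).mpr ⟨haq, ((hp _ _ _).mp rfl).2.symm⟩⟩)
      simp only [N, E, mem_union, mem_filter, mem_univ, true_and, not_or, not_not, not_exists]
        at hnot
      exact ⟨hnot.1, fun l hl h => hnot.2 l ⟨hl, h⟩⟩
  · have h0 := hf 0 (by omega)
    let N := (range t).biUnion fun l => ((T l).neighborSet (f 0)).toFinset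
    have hN : N.card ≤ t * (2 * t - 1) := by
      refine (card_biUnion_le_card_mul _ _ (2 * t - 1) fun l hl => ?_).trans
        (by rw [card_range])
      have hl := mem_range.mp hl
      have k₁ := ncard_neighborSet_add_le (hT l hl) (h0.ne_root l hl)
      have k₂ := hdeg l hl
      rw [← Set.ncard_eq_toFinset_card']
      omega
    refine ⟨(((range t).image f) ∪ N).image fun b => p q (φ s(f 0, b)), ?_,
      fun a haS haR => ⟨fun h => absurd h (lt_irrefl _), fun _ => ?_⟩⟩
    · have k₁ : ((((range t).image f) ∪ N).image fun b => p q (φ s(f 0, b))).card ≤ _ :=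
        card_image_le
      have k₂ := card_union_le ((range t).image f) N
      have k₃ : ((range t).image f).card ≤ t := card_image_le.trans (card_range t).le
      have k₄ : 3 * t + 1 + 3 * t + (t + t * (2 * t - 1)) < n := by
        rcases hK.lt_or_eq with hK | rfl
        · obtain ⟨u, rfl⟩ : ∃ u, t = u + 2 := ⟨t - 2, by omega⟩
          have : 2 * (u + 2) - 1 = 2 * u + 3 := by omega
          rw [this]
          nlinarith
        · omega
      omega
    · have haq := (hS a haS).1
      have hnot : p (f 0) (φ s(q, a)) ∉ ((range t).image f) ∪ N := fun h =>
        haR (mem_image.mpr ⟨_, h, (hp _ _ _).mpr ⟨haq, ((hp _ _ _).mp rfl).2.symm⟩⟩)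
      simp only [N, mem_union, mem_image, mem_range, mem_biUnion, Set.mem_toFinset, not_or,
        not_exists, SimpleGraph.mem_neighborSet] at hnot
      exact ⟨fun j hj h => hnot.1 j ⟨hj, h.symm⟩, fun l hl h => hnot.2 l ⟨hl, h⟩⟩

end Admissible

theorem Sym2.mk_ne_mk_of_ne {α : Type*} {a b c d : α} (hc : c ≠ a) (hd : d ≠ a) :
    s(a, b) ≠ s(c, d) := by
  rw [Ne, Sym2.eq_iff]
  rintro (⟨h, -⟩ | ⟨h, -⟩)
  · exact hc h.symm
  · exact hd h.symm

/-- Given `K` edge-disjoint rainbow spanning trees whose roots have large degree and many adjacent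
leaves, one can modify each of them slightly and add one more such tree. -/
theorem exists_rainbow_tree_extension {n K : ℕ} {φ : Sym2 (Fin n) → Fin (n - 1)}
    (hφ : ProperEdgeColoring φ) {T : ℕ → SimpleGraph (Fin n)} {r : ℕ → Fin n}
    (hTree : ∀ l < K, (T l).IsTree) (hT : ∀ l < K, Set.InjOn φ (T l).edgeSet)
    (hdisj : ∀ i < K, ∀ j < K, i ≠ j → Disjoint (T i).edgeSet (T j).edgeSet)
    (hr : ∀ i < K, ∀ j < K, r i = r j → i = j)
    (hK : 1 ≤ K) (hn : 3 * K ^ 2 + 6 * K ≤ n) (hn' : n ≠ 9)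
    (hleaf : ∀ l < K, n + 3 ≤ leavesAdj (T l) (r l) + 4 * K)
    (hleaf' : ∀ l < K, n + 2 * l + 1 ≤ leavesAdj (T l) (r l) + 4 * K)
    (hdeg : ∀ l < K, n + 1 ≤ ((T l).neighborSet (r l)).ncard + 2 * K) :
    ∃ (T' : ℕ → SimpleGraph (Fin n)) (S : SimpleGraph (Fin n)) (q : Fin n),
      (∀ l < K, q ≠ r l) ∧
      (∀ l < K, (T' l).IsTree ∧ Set.InjOn φ (T' l).edgeSet ∧
        Disjoint (T' l).edgeSet S.edgeSet ∧
        ((T' l).neighborSet (r l)).ncard + 2 = ((T l).neighborSet (r l)).ncard ∧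
        leavesAdj (T l) (r l) ≤ leavesAdj (T' l) (r l) + 4) ∧
      (∀ i < K, ∀ j < K, i ≠ j → Disjoint (T' i).edgeSet (T' j).edgeSet) ∧
      S.IsTree ∧ Set.InjOn φ S.edgeSet ∧ (S.neighborSet q).ncard + (K + 2) = n ∧
      n ≤ leavesAdj S q + (2 * K + 3) := by
  classical
  obtain ⟨p, hp⟩ := hφ.exists_partner
  have hp1 : ∀ a c, p a c ≠ a := fun a c => ((hp a c _).mp rfl).1
  have hp2 : ∀ a c, φ s(a, p a c) = c := fun a c => ((hp a c _).mp rfl).2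
  have hφ' : ∀ a b b', b ≠ a → b' ≠ a → φ s(a, b) = φ s(a, b') → b = b' := by
    intro a b b' h h' he
    by_contra hne
    exact hφ a b b' h.symm h'.symm hne he
  obtain ⟨q, hq⟩ := exists_common_leaf (K := K) T r (by nlinarith) hleaf'
  have hqr : ∀ l < K, q ≠ r l := fun l hl => (hq l hl).1.ne'
  have hqT : ∀ l < K, ∀ w, (T l).Adj q w → w = r l := fun l hl w hw =>
    (hq l hl).1.symm.eq_of_ncard_neighborSet (hq l hl).2 hw
  have : Inhabited (Fin n) := ⟨q⟩
  obtain ⟨x, hx⟩ := exists_seq_of_forall_prefix (IsAdmissible φ p T r q K)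
    (fun t f g a => IsAdmissible.congr hK) (K + 1)
    (fun t ht f hf => exists_admissible hp hT hK hn hn' (fun l hl => (hq l hl).1) hleaf hdeg t
      (Nat.lt_succ_iff.mp ht) f hf)
  have hxq : ∀ i < K + 1, x i ≠ q := fun i hi => (hx i hi).ne_center
  have hxr : ∀ i < K + 1, ∀ l < K, x i ≠ r l := fun i hi => (hx i hi).ne_root
  have hxinj : ∀ i < K + 1, ∀ j < K + 1, x i = x j → i = j := by
    intro i hi j hj h
    rcases lt_trichotomy i j with hij | hij | hij
    · exact absurd h.symm ((hx j hj).ne_prev i hij)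
    · exact hij
    · exact absurd h ((hx i hi).ne_prev j hij)
  let v : ℕ → Fin n := fun i => p (r i) (φ s(q, x i))
  let y : ℕ → Fin n := fun i => p (v i) (φ s(r i, q))
  have hv : ∀ i < K, (T i).Adj (r i) (v i) ∧ ((T i).neighborSet (v i)).ncard = 1 :=
    fun i hi => (hx i (by omega)).leaf hi
  have hvφ : ∀ i, φ s(r i, v i) = φ s(q, x i) := fun i => hp2 _ _
  have hyφ : ∀ i, φ s(v i, y i) = φ s(r i, q) := fun i => hp2 _ _
  have hyv : ∀ i, y i ≠ v i := fun i => hp1 _ _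
  have hvr : ∀ i, v i ≠ r i := fun i => hp1 _ _
  have hvT : ∀ i < K, ∀ l < K, ¬ (T l).Adj (v i) (y i) :=
    fun i hi => (hx i (by omega)).leaf_not_adj hi
  have hvq : ∀ i < K, v i ≠ q := by
    intro i hi h
    refine hxr i (by omega) i hi (hφ' q _ _ (hxq i (by omega)) (hqr i hi).symm ?_)
    rw [← hvφ, h, Sym2.eq_swap]
  have hxv : ∀ i < K, x i ≠ v i := by
    intro i hi h
    refine hqr i hi (hφ' (v i) _ _ (hvq i hi).symm (hvr i).symm ?_)
    rw [Sym2.eq_swap (b := r i), hvφ, h, Sym2.eq_swap]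
  have hyq : ∀ i < K, y i ≠ q := by
    intro i hi h
    refine hvr i (hφ' q _ _ (hvq i hi) (hqr i hi).symm ?_)
    rw [Sym2.eq_swap (a := q) (b := r i), ← hyφ, h, Sym2.eq_swap]
  have hyr : ∀ i < K, y i ≠ r i := by
    intro i hi h
    refine hvq i hi (hφ' (r i) _ _ (hvr i) (hqr i hi) ?_)
    rw [← hyφ, h, Sym2.eq_swap]
  let x' : Fin (K + 1) → Fin n := fun i => x i
  let σ : Fin (K + 1) → Fin (K + 1) := fun i =>
    if h : (i : ℕ) = 0 then ⟨K, K.lt_succ_self⟩ else ⟨i - 1, by omega⟩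
  have hσ : σ.Injective := by
    intro i j h
    ext
    simp only [σ] at h
    split_ifs at h <;> simp only [Fin.mk.injEq] at h <;> omega
  have hσne : ∀ i, σ i ≠ i := by
    intro i h
    have := congrArg Fin.val h
    simp only [σ] at this
    split_ifs at this <;> simp only at this <;> omega
  let z : Fin (K + 1) → Fin n := fun i => p (x i) (φ s(q, x (σ i)))
  have hzφ : ∀ i, φ s(x' i, z i) = φ s(q, x' (σ i)) := fun i => hp2 _ _
  have hx'inj : x'.Injective := fun i j h => Fin.ext (hxinj i i.2 j j.2 h)
  have hx'q : ∀ i, x' i ≠ q := fun i => hxq i i.2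
  have hzq : ∀ i, z i ≠ q := by
    intro i h
    refine hσne i (hx'inj (hφ' q _ _ (hx'q _) (hx'q _) ?_))
    rw [← hzφ, h, Sym2.eq_swap]
  have hσ0 : ∀ i : Fin (K + 1), (i : ℕ) = 0 → (σ i : ℕ) = K := fun i h => by
    simp only [σ, h, dite_true]
  have hσs : ∀ i : Fin (K + 1), (i : ℕ) ≠ 0 → (i : ℕ) = (σ i : ℕ) + 1 := fun i h => by
    simp only [σ, h, dite_false]; omega
  have hzx : ∀ i j, z i ≠ x' j := by
    intro i j h
    rcases eq_or_ne i j with rfl | hij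
    · exact hp1 _ _ h
    have hijv : (i : ℕ) ≠ j := fun h => hij (Fin.ext h)
    have hj := j.2
    by_cases hi0 : (i : ℕ) = 0
    · by_cases hjK : (j : ℕ) = K
      · have h1 := hzφ i
        have h2 : σ i = j := Fin.ext ((hσ0 i hi0).trans hjK.symm)
        rw [h, h2] at h1
        refine hx'q i (hφ' (x' j) _ _ (hx'inj.ne hij) (hx'q j).symm ?_)
        rw [Sym2.eq_swap, h1, Sym2.eq_swap]
      · refine (hx K K.lt_succ_self).last_ne rfl j (by omega) ?_
        have h1 := h
        simp only [z, hσ0 i hi0, hi0] at h1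
        exact h1
    · have his := hσs i hi0
      rcases lt_or_gt_of_ne hijv with hlt | hlt
      · refine (hx j j.2).ne_prev_partner (σ i) (by omega) ?_
        rw [← his]
        exact h.symm
      · exact (hx i i.2).partner_ne (σ i) his j hlt h
  have hzT : ∀ i, ∀ l < K, ¬ (T l).Adj (x' i) (z i) := by
    intro i l hl h
    by_cases hi0 : (i : ℕ) = 0
    · refine (hx K K.lt_succ_self).last_not_adj rfl l hl ?_
      simp only [z, x', hσ0 i hi0, hi0] at h
      exact h
    · exact (hx i i.2).partner_not_adj (σ i) (hσs i hi0) l hl h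
  have hcol : ∀ i < K, ∀ j < K + 1, φ s(r i, q) ≠ φ s(q, x j) := by
    intro i hi j hj h
    refine hxr j hj i hi (hφ' q _ _ (hxq j hj) (hqr i hi).symm ?_)
    rw [← h, Sym2.eq_swap]
  have hmem := fun i (hi : i < K) => mem_edgeSet_swapEdges (G := T i) (r := r i) (q := q) (v := v i)
    (hxq i (by omega)) (hyv i)
  have hconn : ∀ i < K, (swapEdges (T i) (r i) q (v i) (x i) (y i)).Connected := fun i hi =>
    swapEdges_connected (hTree i hi).connected (hq i hi).1 (hq i hi).2 (hv i hi).1 (hv i hi).2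
      (hxq i (by omega)) (hxv i hi) (hyq i hi) (hyv i)
  have hinj : ∀ i < K, Set.InjOn φ (swapEdges (T i) (r i) q (v i) (x i) (y i)).edgeSet :=
    fun i hi => swapEdges_injOn (hT i hi) (hq i hi).1 (hv i hi).1 (hvq i hi) (hxq i (by omega))
      (hyv i) (hvφ i).symm (hyφ i)
  have hSconn := modifiedStar_connected (q := q) hzx
  have hSinj := modifiedStar_injOn hσ hzx hx'inj hx'q (hφ' q) hzφ
  refine ⟨fun i => swapEdges (T i) (r i) q (v i) (x i) (y i), modifiedStar q x' z, q, hqr,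
    fun i hi => ⟨(hconn i hi).isTree_of_injOn (hinj i hi), hinj i hi, ?_, ?_, ?_⟩, ?_,
    hSconn.isTree_of_injOn hSinj, hSinj, ?_, ?_⟩
  · rw [Set.disjoint_left]
    intro e he he'
    rw [hmem i hi] at he
    rw [mem_edgeSet_modifiedStar hzx] at he'
    rcases he' with ⟨w, hwq, hwx, rfl⟩ | ⟨j, rfl⟩
    · rcases he with ⟨h, h1, -⟩ | h | h
      · rw [hqT i hi w h, Sym2.eq_swap] at h1
        exact h1 rfl
      · exact hwx ⟨i, by omega⟩ (Sym2.congr_right.mp h)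
      · exact Sym2.mk_ne_mk_of_ne (hvq i hi) (hyq i hi) h
    · rcases he with ⟨h, -, -⟩ | h | h
      · exact hzT j i hi h
      · exact Sym2.mk_ne_mk_of_ne (hx'q j) (hzq j) h.symm
      · exact hcol i hi (σ j) (σ j).2 (by rw [← hyφ, ← h]; exact hzφ j)
  · exact swapEdges_ncard_neighborSet (hq i hi).1 (hv i hi).1 (hvq i hi) (hxq i (by omega)) (hyv i)
      (hxr i (by omega) i hi) (hyr i hi)
  · exact swapEdges_leavesAdj (hxq i (by omega)) (hyv i)
  · have hcross : ∀ i < K, ∀ j < K, s(q, x i) ≠ s(v j, y j) := fun _ _ j hj =>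
      Sym2.mk_ne_mk_of_ne (hvq j hj) (hyq j hj)
    have hnot : ∀ i < K, ∀ j < K, s(q, x i) ∉ (T j).edgeSet := fun i hi j hj h =>
      hxr i (by omega) j hj (hqT j hj _ h)
    intro i hi j hj hij
    rw [Set.disjoint_left]
    intro e he he'
    rw [hmem i hi] at he
    rw [hmem j hj] at he'
    rcases he with ⟨h, -, -⟩ | rfl | rfl <;> rcases he' with ⟨h', -, -⟩ | h' | h'
    · exact Set.disjoint_left.mp (hdisj i hi j hj hij) h h'
    · exact hnot j hj i hi (h' ▸ h)
    · exact hvT j hj i hi (by rw [← SimpleGraph.mem_edgeSet, ← h']; exact h)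
    · exact hnot i hi j hj h'
    · exact hij (hxinj i (by omega) j (by omega) (Sym2.congr_right.mp h'))
    · exact hcross i hi j hj h'
    · exact hvT i hi j hj h'
    · exact hcross j hj i hi h'.symm
    · refine hij (hr i hi j hj (hφ' q _ _ (hqr i hi).symm (hqr j hj).symm ?_))
      rw [Sym2.eq_swap, ← hyφ i, h', hyφ, Sym2.eq_swap]
  · have := modifiedStar_ncard_neighborSet hzx hx'inj hx'q hzq
    simp only [Fintype.card_fin] at this
    omega
  · have := modifiedStar_leavesAdj hzx hx'q hzq
    simp only [Fintype.card_fin] at this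
    omega

/-- The induction step, from `K` trees to `K + 1` trees. -/
theorem exists_condF_succ {m K : ℕ} (hK : 1 ≤ K) (hbound : 3 * K ^ 2 + 6 * K ≤ 2 * m)
    {φ : Sym2 (Fin (2 * m)) → Fin (2 * m - 1)} (hφ : ProperEdgeColoring φ)
    {T : Fin K → SimpleGraph (Fin (2 * m))} {r : Fin K → Fin (2 * m)}
    (hTtree : ∀ i, (T i).IsTree) (hTrainbow : ∀ i, Set.InjOn φ (T i).edgeSet)
    (hTdisj : ∀ i j, i ≠ j → Disjoint (T i).edgeSet (T j).edgeSet) (hTf : CondF m K T r) :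
    ∃ (T' : Fin (K + 1) → SimpleGraph (Fin (2 * m))) (r' : Fin (K + 1) → Fin (2 * m)),
      (∀ i, (T' i).IsTree) ∧ (∀ i, Set.InjOn φ (T' i).edgeSet) ∧
      (∀ i j, i ≠ j → Disjoint (T' i).edgeSet (T' j).edgeSet) ∧ CondF m (K + 1) T' r' := by
  obtain ⟨hrinj, hf0, hf1⟩ := hTf
  let T₁ : ℕ → SimpleGraph (Fin (2 * m)) := fun i => if h : i < K then T ⟨i, h⟩ else ⊥
  let r₁ : ℕ → Fin (2 * m) := fun i => if h : i < K then r ⟨i, h⟩ else r ⟨0, hK⟩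
  have hT₁ : ∀ i (h : i < K), T₁ i = T ⟨i, h⟩ := fun i h => dif_pos h
  have hr₁ : ∀ i (h : i < K), r₁ i = r ⟨i, h⟩ := fun i h => dif_pos h
  have hleaf' : ∀ l < K, 2 * m + 2 * l + 1 ≤ leavesAdj (T₁ l) (r₁ l) + 4 * K ∧
      2 * m + 3 ≤ leavesAdj (T₁ l) (r₁ l) + 4 * K ∧
      2 * m + 1 ≤ ((T₁ l).neighborSet (r₁ l)).ncard + 2 * K := by
    intro l hl
    rw [hT₁ l hl, hr₁ l hl]
    rcases Nat.eq_zero_or_pos l with h | h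
    · have := hf0 ⟨l, hl⟩ h
      omega
    · have := hf1 ⟨l, hl⟩ h
      simp only at this
      omega
  obtain ⟨T', S, q, hq, hT', hdisj, hS, hSinj, hSdeg, hSleaf⟩ :=
    exists_rainbow_tree_extension (K := K) (T := T₁) (r := r₁) hφ
      (fun l hl => hT₁ l hl ▸ hTtree _) (fun l hl => hT₁ l hl ▸ hTrainbow _)
      (fun i hi j hj hij => by
        rw [hT₁ i hi, hT₁ j hj]
        exact hTdisj _ _ fun h => hij (congrArg Fin.val h))
      (fun i hi j hj h => by
        rw [hr₁ i hi, hr₁ j hj] at h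
        exact congrArg Fin.val (hrinj h))
      hK hbound (by omega) (fun l hl => (hleaf' l hl).2.1) (fun l hl => (hleaf' l hl).1)
      (fun l hl => (hleaf' l hl).2.2)
  refine ⟨Fin.snoc (fun i : Fin K => T' i) S, Fin.snoc r q, fun i => ?_, fun i => ?_,
    fun i j hij => ?_, ?_, fun i hi => ?_, fun i hi => ?_⟩
  · refine Fin.lastCases ?_ (fun i => ?_) i
    · simpa using hS
    · simpa using (hT' i i.2).1
  · refine Fin.lastCases ?_ (fun i => ?_) i
    · simpa using hSinj
    · simpa using (hT' i i.2).2.1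
  · induction i using Fin.lastCases with
    | last =>
      induction j using Fin.lastCases with
      | last => exact absurd rfl hij
      | cast j => simpa using (hT' j j.2).2.2.1.symm
    | cast i =>
      induction j using Fin.lastCases with
      | last => simpa using (hT' i i.2).2.2.1
      | cast j =>
        simpa using hdisj i i.2 j j.2 fun h => hij (congrArg Fin.castSucc (Fin.ext h))
  · rw [Fin.snoc_injective_iff]
    refine ⟨hrinj, ?_⟩
    rintro ⟨i, hi⟩
    exact hq i i.2 (by rw [hr₁ i i.2, ← hi])
  · induction i using Fin.lastCases with
    | last => simp at hi; omega
    | cast i =>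
      obtain ⟨-, -, -, h1, h2⟩ := hT' i i.2
      have h3 := hf0 i hi
      rw [hT₁ i i.2, hr₁ i i.2] at h1 h2
      simp only [Fin.eta] at h1 h2
      simp only [Fin.snoc_castSucc]
      omega
  · induction i using Fin.lastCases with
    | last =>
      simp only [Fin.snoc_last, Fin.val_last]
      omega
    | cast i =>
      obtain ⟨-, -, -, h1, h2⟩ := hT' i i.2
      have h3 := hf1 i hi
      rw [hT₁ i i.2, hr₁ i i.2] at h1 h2
      simp only [Fin.eta] at h1 h2
      simp only [Fin.snoc_castSucc, Fin.val_castSucc]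
      omega

/-- **induction step.** If `m ≥ 1`, `φ` is a proper
`(2m-1)`-edge-coloring of `K_{2m}`, `2 ≤ k ≤ ⌊√(6m+9)/3⌋`, and `K_{2m}` contains
`k-1` pairwise edge-disjoint rainbow spanning trees with designated roots
satisfying `f(k-1)`, then `K_{2m}` contains `k` pairwise edge-disjoint rainbow
spanning trees with designated roots satisfying `f(k)`. -/
theorem statement2 (m k : ℕ) (hm : 1 ≤ m) (hk : 2 ≤ k)
    (hkΩ : k ≤ ⌊Real.sqrt (6 * (m : ℝ) + 9) / 3⌋₊)
    (φ : Sym2 (Fin (2 * m)) → Fin (2 * m - 1))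
    (hφ : ProperEdgeColoring φ)
    (T : Fin (k - 1) → SimpleGraph (Fin (2 * m))) (r : Fin (k - 1) → Fin (2 * m))
    (hTtree : ∀ i, (T i).IsTree)
    (hTrainbow : ∀ i, Set.InjOn φ (T i).edgeSet)
    (hTdisj : ∀ i j, i ≠ j → Disjoint (T i).edgeSet (T j).edgeSet)
    (hTf : CondF m (k - 1) T r) :
    ∃ (T' : Fin k → SimpleGraph (Fin (2 * m))) (r' : Fin k → Fin (2 * m)),
      (∀ i, (T' i).IsTree) ∧
      (∀ i, Set.InjOn φ (T' i).edgeSet) ∧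
      (∀ i j, i ≠ j → Disjoint (T' i).edgeSet (T' j).edgeSet) ∧
      CondF m k T' r' := by
  obtain ⟨K, rfl⟩ : ∃ K, k = K + 1 := ⟨k - 1, by omega⟩
  have hbound : 3 * K ^ 2 + 6 * K ≤ 2 * m := by
    have h1 : ((K + 1 : ℕ) : ℝ) ≤ √(6 * (m : ℝ) + 9) / 3 :=
      (Nat.le_floor_iff (by positivity)).mp hkΩ
    have h2 : (3 * ((K + 1 : ℕ) : ℝ)) ^ 2 ≤ 6 * (m : ℝ) + 9 :=
      (Real.le_sqrt (by positivity) (by positivity)).mp (by linarith)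
    have h3 : (3 * (K + 1)) ^ 2 ≤ 6 * m + 9 := by exact_mod_cast h2
    nlinarith
  exact exists_condF_succ (K := K) (by omega) hbound hφ hTtree hTrainbow hTdisj hTf
end

section
/- Let T be a spanning tree of the complete graph K_n (n ≥ 4) containing a vertex r and two distinct leaves y and v both adjacent to r. Let w and v′ be vertices of K_n with w ≠ y, v′ ≠ v, and such that the edges {y,w} and {v,v′} are distinct. Then the graph T′ = T − ry − rv + yw + vv′, obtained from T by deleting the edges ry and rv and adding the edges yw and vv′, is a spanning tree of K_n. -/
/-- The graph `T[r; y, v; w, v'] = T - ry - rv + yw + vv'`, obtained from `T` by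
removing the edges `ry` and `rv` and adding the edges `yw` and `vv'`. -/
def swapTree {n : ℕ} (T : SimpleGraph (Fin n)) (r y v w v' : Fin n) :
    SimpleGraph (Fin n) :=
  (T.deleteEdges {s(r, y), s(r, v)}) ⊔ SimpleGraph.fromEdgeSet {s(y, w), s(v, v')}

namespace swapTree

variable {n : ℕ} {T : SimpleGraph (Fin n)} {r y v w v' : Fin n}

theorem edgeSet_subset :
    (swapTree T r y v w v').edgeSet ⊆
      (T.edgeSet \ {s(r, y), s(r, v)}) ∪ {s(y, w), s(v, v')} := by
  rw [swapTree, SimpleGraph.edgeSet_sup, SimpleGraph.edgeSet_deleteEdges,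
    SimpleGraph.edgeSet_fromEdgeSet]
  exact Set.union_subset_union_right _ Set.sdiff_subset

theorem ncard_edgeSet_le (hyv : y ≠ v) (hry : T.Adj r y) (hrv : T.Adj r v) :
    (swapTree T r y v w v').edgeSet.ncard ≤ T.edgeSet.ncard := by
  have hne : s(r, y) ≠ s(r, v) := by simp [hyv, hry.ne.symm]
  have hsub : ({s(r, y), s(r, v)} : Set (Sym2 (Fin n))) ⊆ T.edgeSet := by
    rintro e (rfl | rfl) <;> assumption
  have hdiff := Set.ncard_sdiff_add_ncard_of_subset hsub
  rw [Set.ncard_pair hne] at hdiff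
  calc (swapTree T r y v w v').edgeSet.ncard
      ≤ _ := Set.ncard_le_ncard edgeSet_subset
    _ ≤ _ := Set.ncard_union_le _ _
    _ ≤ (T.edgeSet \ {s(r, y), s(r, v)}).ncard + 2 := by
      gcongr
      exact (Set.ncard_insert_le _ _).trans (by simp)
    _ = T.edgeSet.ncard := hdiff

theorem adj_of_adj {a b : Fin n} (hab : T.Adj a b) (hay : a ≠ y) (hav : a ≠ v)
    (hby : b ≠ y) (hbv : b ≠ v) : (swapTree T r y v w v').Adj a b := by
  left
  simp [SimpleGraph.deleteEdges_adj, hab, hay, hav, hby, hbv]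

theorem reachable_of_ne (hT : T.Connected) (hry : T.Adj r y) (hrv : T.Adj r v)
    (hy : ∀ b, T.Adj y b → b = r) (hv : ∀ b, T.Adj v b → b = r)
    {x : Fin n} (hxy : x ≠ y) (hxv : x ≠ v) :
    (swapTree T r y v w v').Reachable x r := by
  let f : Fin n → Fin n := fun a => if a = y ∨ a = v then r else a
  have hf : ∀ a b, T.Adj a b → (swapTree T r y v w v').Reachable (f a) (f b) := by
    intro a b hab
    by_cases ha : a = y ∨ a = v
    · have hb : b = r := by
        rcases ha with rfl | rfl
        exacts [hy b hab, hv b hab]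
      simp [f, ha, hb]
    by_cases hb : b = y ∨ b = v
    · have ha' : a = r := by
        rcases hb with rfl | rfl
        exacts [hy a hab.symm, hv a hab.symm]
      simp [f, hb, ha']
    · simp only [f, ha, hb, if_false]
      push Not at ha hb
      exact (adj_of_adj hab ha.1 ha.2 hb.1 hb.2).reachable
  have hwalk : ∀ {a b}, T.Walk a b → (swapTree T r y v w v').Reachable (f a) (f b) := by
    intro a b p
    induction p with
    | nil => exact .rfl
    | cons h _ ih => exact (hf _ _ h).trans ih
  obtain ⟨p⟩ := hT.preconnected x r
  simpa [f, hxy, hxv, hry.ne, hrv.ne] using hwalk p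

theorem connected (hT : T.Connected) (hry : T.Adj r y) (hrv : T.Adj r v)
    (hy : ∀ b, T.Adj y b → b = r) (hv : ∀ b, T.Adj v b → b = r)
    (hwy : w ≠ y) (hv'v : v' ≠ v) (hedge : s(y, w) ≠ s(v, v')) :
    (swapTree T r y v w v').Connected := by
  have hother {x : Fin n} (hxy : x ≠ y) (hxv : x ≠ v) :
      (swapTree T r y v w v').Reachable x r :=
    reachable_of_ne hT hry hrv hy hv hxy hxv
  have hyw : (swapTree T r y v w v').Reachable y w :=
    SimpleGraph.Adj.reachable (Or.inr (by simp [hwy.symm]))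
  have hvv' : (swapTree T r y v w v').Reachable v v' :=
    SimpleGraph.Adj.reachable (Or.inr (by simp [hv'v.symm]))
  have hboth : (swapTree T r y v w v').Reachable y r ∧
      (swapTree T r y v w v').Reachable v r := by
    by_cases hwv : w = v
    · subst hwv
      have hv'y : v' ≠ y := by
        rintro rfl
        exact hedge Sym2.eq_swap
      have hvr := hvv'.trans (hother hv'y hv'v)
      exact ⟨hyw.trans hvr, hvr⟩
    · have hyr := hyw.trans (hother hwy hwv)
      refine ⟨hyr, hvv'.trans ?_⟩
      by_cases hv'y : v' = y
      · subst hv'y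
        exact hyr
      · exact hother hv'y hv'v
  refine SimpleGraph.connected_iff_exists_forall_reachable _ |>.2 ⟨r, fun x => .symm ?_⟩
  by_cases hxy : x = y
  · exact hxy ▸ hboth.1
  by_cases hxv : x = v
  · exact hxv ▸ hboth.2
  exact hother hxy hxv

end swapTree

theorem SimpleGraph.eq_of_adj_of_ncard_neighborSet_eq_one {V : Type*} {G : SimpleGraph V}
    {a b c : V} (ha : (G.neighborSet a).ncard = 1) (hc : G.Adj c a) (hb : G.Adj a b) :
    b = c := by
  obtain ⟨d, hd⟩ := Set.ncard_eq_one.1 ha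
  have hbd : b ∈ G.neighborSet a := hb
  have hcd : c ∈ G.neighborSet a := hc.symm
  rw [hd, Set.mem_singleton_iff] at hbd hcd
  rw [hbd, hcd]

/-- Let `T` be a spanning tree of `K_n` (`n ≥ 4`) with a vertex `r`
and two distinct leaves `y` and `v` both adjacent to `r`.  Let `w, v'` be vertices
with `w ≠ y`, `v' ≠ v` and `{y,w} ≠ {v,v'}`.  Then `T' = T - ry - rv + yw + vv'`
is a spanning tree of `K_n`. -/
theorem statement3 (n : ℕ) (hn : 4 ≤ n)
    (T : SimpleGraph (Fin n)) (hT : T.IsTree)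
    (r y v w v' : Fin n)
    (hyv : y ≠ v) (hry : T.Adj r y) (hrv : T.Adj r v)
    (hyleaf : (T.neighborSet y).ncard = 1) (hvleaf : (T.neighborSet v).ncard = 1)
    (hwy : w ≠ y) (hv'v : v' ≠ v) (hedge : s(y, w) ≠ s(v, v')) :
    (swapTree T r y v w v').IsTree := by
  have hconn : (swapTree T r y v w v').Connected :=
    swapTree.connected hT.connected hry hrv
      (fun _ => SimpleGraph.eq_of_adj_of_ncard_neighborSet_eq_one hyleaf hry)
      (fun _ => SimpleGraph.eq_of_adj_of_ncard_neighborSet_eq_one hvleaf hrv) hwy hv'v hedge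
  have hcard := (SimpleGraph.isTree_iff_connected_and_card.1 hT).2
  have hlower := hconn.card_vert_le_card_edgeSet_add_one
  have hupper := swapTree.ncard_edgeSet_le (w := w) (v' := v') hyv hry hrv
  rw [← Nat.card_coe_set_eq, ← Nat.card_coe_set_eq] at hupper
  exact SimpleGraph.isTree_iff_connected_and_card.2 ⟨hconn, by lia⟩
end

section
/- Let T be a spanning tree of the complete graph K_n containing a vertex r and two distinct leaves y and v both adjacent to r, and let w and v′ be vertices distinct from r with w ≠ y, v′ ≠ v, and the edges {y,w}, {v,v′} distinct. Set T′ = T − ry − rv + yw + vv′. Then the degree of r in T′ equals the degree of r in T minus 2, and the number of leaves of T′ adjacent to r is at least the number of leaves of T adjacent to r minus 4. -/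
theorem swapTree_adj {n : ℕ} {T : SimpleGraph (Fin n)} {r y v w v' a b : Fin n} :
    (swapTree T r y v w v').Adj a b ↔
      (T.Adj a b ∧ s(a, b) ≠ s(r, y) ∧ s(a, b) ≠ s(r, v)) ∨
        ((s(a, b) = s(y, w) ∨ s(a, b) = s(v, v')) ∧ a ≠ b) := by
  simp only [swapTree, SimpleGraph.sup_adj, SimpleGraph.deleteEdges_adj,
    SimpleGraph.fromEdgeSet_adj, Set.mem_insert_iff, Set.mem_singleton_iff, not_or, ne_eq]

theorem swapTree_neighborSet_root {n : ℕ} {T : SimpleGraph (Fin n)} {r y v w v' : Fin n}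
    (hry : r ≠ y) (hrv : r ≠ v) (hwr : w ≠ r) (hv'r : v' ≠ r) :
    (swapTree T r y v w v').neighborSet r = T.neighborSet r \ {y, v} := by
  ext x
  simp only [SimpleGraph.mem_neighborSet, swapTree_adj, Set.mem_sdiff, Set.mem_insert_iff,
    Set.mem_singleton_iff, Sym2.eq_iff]
  grind

theorem swapTree_neighborSet_of_ne {n : ℕ} {T : SimpleGraph (Fin n)} {r y v w v' x : Fin n}
    (hr : x ≠ r) (hy : x ≠ y) (hv : x ≠ v) (hw : x ≠ w) (hv' : x ≠ v') :
    (swapTree T r y v w v').neighborSet x = T.neighborSet x := by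
  ext z
  simp only [SimpleGraph.mem_neighborSet, swapTree_adj, Sym2.eq_iff]
  grind

/-- Let `T` be a spanning tree of `K_n` with a vertex `r` and two
distinct leaves `y, v` adjacent to `r`, and let `w, v'` be vertices distinct from
`r` with `w ≠ y`, `v' ≠ v` and `{y,w} ≠ {v,v'}`.  Then in
`T' = T - ry - rv + yw + vv'` the degree of `r` is the degree of `r` in `T` minus
two, and the number of leaves of `T'` adjacent to `r` is at least the number of
leaves of `T` adjacent to `r` minus four. -/
theorem statement5 (n : ℕ)
    (T : SimpleGraph (Fin n)) (hT : T.IsTree)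
    (r y v w v' : Fin n)
    (hyv : y ≠ v) (hry : T.Adj r y) (hrv : T.Adj r v)
    (hyleaf : (T.neighborSet y).ncard = 1) (hvleaf : (T.neighborSet v).ncard = 1)
    (hwr : w ≠ r) (hv'r : v' ≠ r)
    (hwy : w ≠ y) (hv'v : v' ≠ v) (hedge : s(y, w) ≠ s(v, v')) :
    (((swapTree T r y v w v').neighborSet r).ncard : ℤ) =
      ((T.neighborSet r).ncard : ℤ) - 2 ∧
    (leavesAdj (swapTree T r y v w v') r : ℤ) ≥ (leavesAdj T r : ℤ) - 4 := by
  have hroot := swapTree_neighborSet_root (T := T) hry.ne hrv.ne hwr hv'r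
  constructor
  · have hsub : ({y, v} : Set (Fin n)) ⊆ T.neighborSet r := by
      rintro x (rfl | rfl) <;> assumption
    have hcard := Set.ncard_sdiff_add_ncard_of_subset hsub
    rw [Set.ncard_pair hyv] at hcard
    rw [hroot]
    omega
  · have hsub : {x | T.Adj r x ∧ (T.neighborSet x).ncard = 1} \ {y, v, w, v'} ⊆
        {x | (swapTree T r y v w v').Adj r x ∧
          ((swapTree T r y v w v').neighborSet x).ncard = 1} := by
      rintro x ⟨⟨hx, hleaf⟩, hne⟩
      simp only [Set.mem_insert_iff, Set.mem_singleton_iff, not_or] at hne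
      obtain ⟨hy, hv, hw, hv'⟩ := hne
      refine ⟨?_, ?_⟩
      · rw [← SimpleGraph.mem_neighborSet, hroot]
        exact ⟨hx, by simp [hy, hv]⟩
      · rwa [swapTree_neighborSet_of_ne hx.ne' hy hv hw hv']
    have hmono := Set.ncard_le_ncard hsub (Set.toFinite _)
    have hdiff := Set.le_ncard_sdiff {y, v, w, v'}
      {x | T.Adj r x ∧ (T.neighborSet x).ncard = 1} (Set.toFinite _)
    have hfour : ({y, v, w, v'} : Set (Fin n)).ncard ≤ 4 := by
      have h₁ := Set.ncard_insert_le y {v, w, v'}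
      have h₂ := Set.ncard_insert_le v {w, v'}
      have h₃ := Set.ncard_insert_le w {v'}
      have h₄ := Set.ncard_singleton v'
      omega
    unfold leavesAdj
    omega
end
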